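/- Let p and q be distinct odd primes and let x, y be nonzero integers with x^p − y^q = 1. Then p^2 divides y, q^2 divides x, p^{q−1} ≡ 1 (mod q^2), and q^{p−1} ≡ 1 (mod p^2). -/

import Mathlib

theorem mf_geom1 (n : ℕ) (x : ℤ) : ∃ k, ∑ i ∈ Finset.range n, x ^ i = n + (x - 1) * k := by
  have : ∀ i : ℕ, ∃ k, x ^ i = 1 + (x - 1) * k := fun i => by
    obtain ⟨k, hk⟩ := sub_one_dvd_pow_sub_one x i
    exact ⟨k, by linarith⟩
  choose f hf using this
  refine ⟨∑ i ∈ Finset.range n, f i, ?_⟩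
  rw [Finset.sum_congr rfl (fun i _ => hf i), Finset.sum_add_distrib, Finset.mul_sum]
  simp

theorem mf_geom2 (p : ℕ) (hpo : Odd p) (x : ℤ) (hx : (p : ℤ) ∣ x - 1) :
    ∃ k, ∑ i ∈ Finset.range p, x ^ i = p * (1 + (x - 1) * k) := by
  have h1 : ∀ i : ℕ, ∃ k, x ^ i = 1 + (x - 1) * (i + (x - 1) * k) := fun i => by
    obtain ⟨k, hk⟩ := mf_geom1 i x
    refine ⟨k, ?_⟩
    rw [← hk, mul_geom_sum]; ring
  choose f hf using h1
  obtain ⟨m, hm⟩ := hpo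
  obtain ⟨c, hc⟩ := hx
  have h2 : ∑ i ∈ Finset.range p, (i : ℤ) = p * m := by
    have := Finset.sum_range_id_mul_two p
    have h3 : (∑ i ∈ Finset.range p, (i : ℕ)) = p * m := by
      have h4 : p - 1 = 2 * m := by omega
      rw [h4] at this; linarith
    rw [← Nat.cast_sum, h3, Nat.cast_mul]
  refine ⟨m + c * ∑ i ∈ Finset.range p, f i, ?_⟩
  rw [Finset.sum_congr rfl (fun i _ => hf i), Finset.sum_add_distrib, ← Finset.mul_sum,
    Finset.sum_add_distrib, ← Finset.mul_sum, h2]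
  simp
  rw [hc]; ring

/-- odd-power root extraction from a coprime product -/
theorem mf_root (q : ℕ) (hqo : Odd q) (a b c : ℤ) (hab : IsCoprime a b) (h : a * b = c ^ q) :
    ∃ d, a = d ^ q := by
  obtain ⟨d, hd⟩ := exists_associated_pow_of_mul_eq_pow' hab h
  rcases Int.associated_iff.1 hd with hd | hd
  · exact ⟨d, hd.symm⟩
  · exact ⟨-d, by rw [hqo.neg_pow, hd, neg_neg]⟩

theorem mf_cop1 (p : ℕ) (hp : p.Prime) (x : ℤ) (h : ¬ (p : ℤ) ∣ x - 1) :
    IsCoprime (x - 1) (∑ i ∈ Finset.range p, x ^ i) := by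
  obtain ⟨k, hk⟩ := mf_geom1 p x
  rw [hk]
  have : IsCoprime (x - 1) (p : ℤ) :=
    ((Nat.prime_iff_prime_int.1 hp).irreducible.coprime_iff_not_dvd.2 h).symm
  exact this.add_mul_left_right k

theorem mf_dvd_sub_one (p : ℕ) (hp : p.Prime) (x : ℤ) (h : (p : ℤ) ∣ x ^ p - 1) :
    (p : ℤ) ∣ x - 1 := by
  have := Fact.mk hp
  have h1 : ((x ^ p - 1 : ℤ) : ZMod p) = 0 := (ZMod.intCast_zmod_eq_zero_iff_dvd _ _).2 (by exact_mod_cast h)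
  have h2 : ((x - 1 : ℤ) : ZMod p) = 0 := by
    push_cast at h1 ⊢
    rwa [ZMod.pow_card] at h1
  exact_mod_cast (ZMod.intCast_zmod_eq_zero_iff_dvd _ _).1 h2

/-- Cassels' relations -/
theorem mf_rel (p q : ℕ) (hp : p.Prime) (hq : q.Prime)
    (hpo : Odd p) (hqo : Odd q) (x y : ℤ) (hy : y ≠ 0)
    (h : x ^ p - y ^ q = 1) (hpy : (p : ℤ) ∣ y) :
    ∃ a u k : ℤ, x - 1 = p ^ (q - 1) * a ^ q ∧ ∑ i ∈ Finset.range p, x ^ i = p * u ^ q ∧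
      y = p * a * u ∧ u ^ q = 1 + (x - 1) * k ∧ 0 < u := by
  have hp0 : (p : ℤ) ≠ 0 := by exact_mod_cast hp.ne_zero
  have hxp : (p : ℤ) ∣ x - 1 := by
    apply mf_dvd_sub_one p hp
    rw [show x ^ p - 1 = y ^ q by linarith]
    exact dvd_pow hpy hq.ne_zero
  obtain ⟨k, hk⟩ := mf_geom2 p hpo x hxp
  obtain ⟨y', rfl⟩ := hpy
  set w := 1 + (x - 1) * k with hw
  have hcw : IsCoprime (x - 1) w := ⟨-k, 1, by rw [hw]; ring⟩
  have hpw : IsCoprime ((p : ℤ) ^ (q - 1)) w := (hcw.of_isCoprime_of_dvd_left hxp).pow_left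
  have e1 : (x - 1) * (p * w) = (p * y') ^ q := by
    rw [← hk, mul_geom_sum]; linarith
  have hq1 : q = (q - 1) + 1 := by have := hq.pos; omega
  have e2 : (x - 1) * w = p ^ (q - 1) * y' ^ q := by
    apply mul_left_cancel₀ hp0
    have : (p : ℤ) ^ q = p * p ^ (q - 1) := by
      conv_lhs => rw [hq1]
      rw [pow_succ]; ring
    rw [mul_pow, this] at e1
    linarith
  obtain ⟨X, hX⟩ : (p : ℤ) ^ (q - 1) ∣ x - 1 :=
    hpw.dvd_of_dvd_mul_right (Dvd.intro _ e2.symm)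
  have e3 : X * w = y' ^ q := by
    apply mul_left_cancel₀ (pow_ne_zero (q - 1) hp0)
    rw [← e2, hX]; ring
  have hXw : IsCoprime X w := hcw.of_isCoprime_of_dvd_left (Dvd.intro_left _ hX.symm)
  obtain ⟨a, ha⟩ := mf_root q hqo X w y' hXw e3
  obtain ⟨u, hu⟩ := mf_root q hqo w X y' hXw.symm (by rw [mul_comm]; exact e3)
  refine ⟨a, u, k, by rw [hX, ha], by rw [hk, hu], ?_, hu.symm, ?_⟩
  · have : y' = a * u := by
      apply hqo.strictMono_pow.injective
      show y' ^ q = (a * u) ^ q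
      rw [mul_pow, ← ha, ← hu, e3]
    rw [this]; ring
  · have h0 : 0 < ∑ i ∈ Finset.range p, x ^ i := hpo.geom_sum_pos
    rw [hk, hu] at h0
    have : 0 < u ^ q := by
      have : (0 : ℤ) < p := by exact_mod_cast hp.pos
      exact (mul_pos_iff_of_pos_left this).1 h0
    exact hqo.pow_pos_iff.1 this

/-- l^p norm comparison in integer form -/
theorem mf_norm (p q a : ℕ) (hpq : p < q) (ha : 0 < a) :
    (a ^ q + 1) ^ p < (a ^ p + 1) ^ q := by
  have hA : 0 < a ^ p := pow_pos ha p
  have h1 : a ^ q + 1 ≤ (a ^ p + 1) * a ^ (q - p) := by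
    have : a ^ q = a ^ p * a ^ (q - p) := by rw [← pow_add]; congr 1; omega
    have h2 : 1 ≤ a ^ (q - p) := Nat.one_le_pow _ _ ha
    rw [this]; nlinarith
  have h3 : (a ^ (q - p)) ^ p < (a ^ p + 1) ^ (q - p) := by
    rw [← pow_mul, mul_comm, pow_mul]
    exact Nat.pow_lt_pow_left (by omega) (by omega)
  calc (a ^ q + 1) ^ p ≤ ((a ^ p + 1) * a ^ (q - p)) ^ p := Nat.pow_le_pow_left h1 p
    _ = (a ^ p + 1) ^ p * (a ^ (q - p)) ^ p := mul_pow _ _ _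
    _ < (a ^ p + 1) ^ p * (a ^ p + 1) ^ (q - p) := by
        apply Nat.mul_lt_mul_of_pos_left h3; positivity
    _ = _ := by rw [← pow_add]; congr 1; omega

theorem mf_norm2 (p q c : ℕ) (hpq : p < q) (hp : 0 < p) (hc : 2 ≤ c) :
    (c ^ p - 1) ^ q < (c ^ q - 1) ^ p := by
  have hA : 1 < c ^ p := Nat.one_lt_pow hp.ne' (by omega)
  obtain ⟨A, hA'⟩ : ∃ A, c ^ p = A + 1 := ⟨c ^ p - 1, by omega⟩
  have h1 : (c ^ p - 1) * c ^ (q - p) ≤ c ^ q - 1 := by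
    have : c ^ q = c ^ p * c ^ (q - p) := by rw [← pow_add]; congr 1; omega
    have h2 : 1 ≤ c ^ (q - p) := Nat.one_le_pow _ _ (by omega)
    rw [this, Nat.sub_mul, one_mul]; omega
  have h3 : (c ^ p - 1) ^ (q - p) < (c ^ (q - p)) ^ p := by
    rw [← pow_mul, mul_comm, pow_mul]
    exact Nat.pow_lt_pow_left (by omega) (by omega)
  calc (c ^ p - 1) ^ q = (c ^ p - 1) ^ p * (c ^ p - 1) ^ (q - p) := by
        rw [← pow_add]; congr 1; omega
    _ < (c ^ p - 1) ^ p * (c ^ (q - p)) ^ p := by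
        apply Nat.mul_lt_mul_of_pos_left h3
        apply pow_pos; omega
    _ = ((c ^ p - 1) * c ^ (q - p)) ^ p := (mul_pow _ _ _).symm
    _ ≤ _ := Nat.pow_le_pow_left h1 p

theorem mf_succ (p : ℕ) (hp : 2 ≤ p) (X : ℤ) (hX : 1 ≤ X) : X ^ p + 1 < (X + 1) ^ p := by
  obtain ⟨n, rfl⟩ : ∃ n, p = n + 1 := ⟨p - 1, by omega⟩
  have h1 : X ^ n ≤ (X + 1) ^ n := pow_le_pow_left₀ (by linarith) (by linarith) n
  have h2 : 2 ≤ (X + 1) ^ n := by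
    calc (2 : ℤ) ≤ (X + 1) ^ 1 := by linarith
      _ ≤ (X + 1) ^ n := pow_le_pow_right₀ (by linarith) (by omega)
  rw [pow_succ, pow_succ]
  nlinarith

theorem mf_easy (p q : ℕ) (hp : p.Prime) (hpo : Odd p) (hqo : Odd q)
    (hpq : p < q) (x y : ℤ) (hx : x ≠ 0) (hy : y ≠ 0)
    (h : x ^ p - y ^ q = 1) : (p : ℤ) ∣ y := by
  by_contra hpy
  have hxp : ¬ (p : ℤ) ∣ x - 1 := fun hd => hpy (by
    have : (p : ℤ) ∣ y ^ q := by
      rw [show y ^ q = x ^ p - 1 by linarith]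
      exact hd.trans (sub_one_dvd_pow_sub_one x p)
    exact Int.Prime.dvd_pow' hp this)
  have hc := mf_cop1 p hp x hxp
  obtain ⟨a, ha⟩ := mf_root q hqo _ _ y hc (by rw [mul_geom_sum]; linarith)
  have hx1 : x = a ^ q + 1 := by linarith
  have hq0 : q ≠ 0 := by omega
  have hp0 := hp.pos
  have hsm : StrictMono (fun z : ℤ => z ^ q) := hqo.strictMono_pow
  have hsmp : StrictMono (fun z : ℤ => z ^ p) := hpo.strictMono_pow
  rcases lt_trichotomy a 0 with ha0 | ha0 | ha0
  · -- negative
    obtain ⟨c, hc⟩ : ∃ c : ℕ, a = -c := ⟨a.natAbs, by omega⟩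
    have hc2 : 2 ≤ c := by
      by_contra hlt
      have : c = 1 := by omega
      subst this
      apply hx; rw [hx1, hc, hqo.neg_pow]; simp
    have hn := mf_norm2 p q c hpq hp0 hc2
    have h1 : 1 ≤ c ^ p := Nat.one_le_pow _ _ (by omega)
    have h2 : 1 ≤ c ^ q := Nat.one_le_pow _ _ (by omega)
    have hn' : ((c : ℤ) ^ p - 1) ^ q < ((c : ℤ) ^ q - 1) ^ p := by
      have := (Nat.cast_lt (α := ℤ)).2 hn
      push_cast [Nat.cast_sub h1, Nat.cast_sub h2] at this
      exact this
    have hx2 : x = -((c : ℤ) ^ q - 1) := by rw [hx1, hc, hqo.neg_pow]; ring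
    have hy2 : (-y) ^ q = ((c : ℤ) ^ q - 1) ^ p + 1 := by
      have := h
      rw [hx2, hpo.neg_pow] at this
      rw [hqo.neg_pow]; linarith
    have hlow : (c : ℤ) ^ p - 1 < -y := hsm.lt_iff_lt.1 (by
      show ((c : ℤ) ^ p - 1) ^ q < (-y) ^ q
      rw [hy2]; linarith)
    have hhigh : -y < (c : ℤ) ^ p := hsm.lt_iff_lt.1 (by
      show (-y) ^ q < ((c : ℤ) ^ p) ^ q
      rw [hy2, ← pow_mul, mul_comm, pow_mul]
      set X : ℤ := (c : ℤ) ^ q with hX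
      have hX2 : 2 ≤ X := by
        have : c ^ 1 ≤ c ^ q := Nat.pow_le_pow_right (by omega) (by omega)
        have : 2 ≤ c ^ q := by rw [pow_one] at this; omega
        rw [hX]; exact_mod_cast this
      have := mf_succ p hp.two_le (X - 1) (by linarith)
      rw [sub_add_cancel] at this
      linarith)
    omega
  · subst ha0
    rw [zero_pow hq0] at hx1
    subst hx1
    simp at h
    exact hy h.1
  · obtain ⟨c, hc⟩ : ∃ c : ℕ, a = c := ⟨a.natAbs, by omega⟩
    have hn := mf_norm p q c hpq (by omega)
    have hn' : ((c : ℤ) ^ q + 1) ^ p < ((c : ℤ) ^ p + 1) ^ q := by exact_mod_cast hn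
    have hy2 : y ^ q = ((c : ℤ) ^ q + 1) ^ p - 1 := by
      rw [← hc, ← hx1]; linarith
    have hhigh : y < (c : ℤ) ^ p + 1 := hsm.lt_iff_lt.1 (by
      show y ^ q < _; linarith)
    have hlow : (c : ℤ) ^ p < y := hsm.lt_iff_lt.1 (by
      show ((c : ℤ) ^ p) ^ q < y ^ q
      rw [hy2, ← pow_mul, mul_comm, pow_mul]
      set X : ℤ := (c : ℤ) ^ q with hX
      have hX2 : 1 ≤ X := by
        have : 1 ≤ c ^ q := Nat.one_le_pow _ _ (by omega)
        rw [hX]; exact_mod_cast this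
      have := mf_succ p hp.two_le X hX2
      linarith)
    omega


theorem mf_choose_prod (s : ℝ) (k : ℕ) :
    (k.factorial : ℝ) * Ring.choose s k = ∏ i ∈ Finset.range k, (s - i) := by
  have h := Ring.descPochhammer_eq_factorial_smul_choose s k
  rw [nsmul_eq_mul] at h
  rw [← h, ← descPochhammer_eval_eq_prod_range, ← descPochhammer_map (algebraMap ℤ ℝ),
    Polynomial.eval_map_algebraMap, Polynomial.aeval_eq_smeval]

theorem mf_choose_prodZ (s : ℤ) (k : ℕ) :
    (k.factorial : ℤ) * Ring.choose s k = ∏ i ∈ Finset.range k, (s - i) := by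
  have h := Ring.descPochhammer_eq_factorial_smul_choose s k
  rw [nsmul_eq_mul] at h
  rw [← h, ← descPochhammer_eval_eq_prod_range, Polynomial.eval_eq_smeval]

theorem mf_choose_succ (s : ℝ) (k : ℕ) :
    ((k : ℝ) + 1) * Ring.choose s (k + 1) = Ring.choose s k * (s - k) := by
  have h1 := mf_choose_prod s (k + 1)
  rw [Finset.prod_range_succ, ← mf_choose_prod s k, Nat.factorial_succ] at h1
  push_cast at h1
  have : (k.factorial : ℝ) ≠ 0 := by exact_mod_cast k.factorial_ne_zero
  apply mul_left_cancel₀ this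
  linarith

theorem mf_choose_bound (s : ℝ) (hs : 0 ≤ s) (m : ℕ) (h1 : (m : ℝ) - 1 ≤ s) (h2 : s ≤ m) (k : ℕ)
    (hk : m ≤ k) : |Ring.choose s k| ≤ 1 := by
  induction k, hk using Nat.le_induction with
  | base =>
    have hf : (0 : ℝ) < m.factorial := by exact_mod_cast m.factorial_pos
    have e := mf_choose_prod s m
    have e2 : (m.factorial : ℝ) = ∏ i ∈ Finset.range m, ((m : ℝ) - i) := by
      have := mf_choose_prod (m : ℝ) m
      rw [Ring.choose_natCast] at this
      simpa using this
    have hnn : ∀ i ∈ Finset.range m, 0 ≤ s - i := fun i hi => by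
      have : i + 1 ≤ m := Finset.mem_range.1 hi
      have : (i : ℝ) + 1 ≤ m := by exact_mod_cast this
      linarith
    have h3 : ∏ i ∈ Finset.range m, (s - i) ≤ ∏ i ∈ Finset.range m, ((m : ℝ) - i) :=
      Finset.prod_le_prod hnn (fun i _ => by linarith)
    have h4 : 0 ≤ ∏ i ∈ Finset.range m, (s - i) := Finset.prod_nonneg hnn
    rw [← e] at h3 h4
    rw [← e2] at h3
    rw [abs_of_nonneg (by exact (mul_nonneg_iff_of_pos_left hf).1 h4)]
    exact (mul_le_iff_le_one_right hf).1 h3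
  | succ k hk ih =>
    have e := mf_choose_succ s k
    have hk' : (m : ℝ) ≤ k := by exact_mod_cast hk
    have h3 : |s - k| ≤ k + 1 := by rw [abs_le]; constructor <;> linarith
    have h5 : (0 : ℝ) < k + 1 := by positivity
    have h4 : ((k : ℝ) + 1) * |Ring.choose s (k + 1)| ≤ (k + 1) * 1 := by
      rw [← abs_of_pos h5, ← abs_mul, e, abs_mul, abs_of_pos h5, mul_comm]
      exact mul_le_mul h3 ih (abs_nonneg _) h5.le
    exact le_of_mul_le_mul_left h4 h5

theorem mf_binom_approx (s : ℝ) (hs : 0 ≤ s) (m : ℕ) (h1 : (m : ℝ) - 1 ≤ s) (h2 : s ≤ m) (t : ℝ)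
    (ht : |t| ≤ 1 / 2) :
    |(1 - t) ^ s - ∑ k ∈ Finset.range (m + 1), Ring.choose s k * (-t) ^ k| ≤ 2 * |t| ^ (m + 1) := by
  have H := (Real.one_add_rpow_hasFPowerSeriesOnBall_zero (a := s)).hasSum (y := -t) (by
    simp only [Metric.mem_eball, edist_zero_right]
    rw [enorm_neg, ← ofReal_norm, Real.norm_eq_abs]
    rw [← ENNReal.ofReal_one]
    exact (ENNReal.ofReal_lt_ofReal_iff one_pos).2 (by linarith))
  have H' : HasSum (fun k => Ring.choose s k * (-t) ^ k) ((1 - t) ^ s) := by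
    convert! H using 1
    · ext k
      rw [binomialSeries_apply]
      simp
    · simp [sub_eq_add_neg]
  have H2 := (hasSum_nat_add_iff' (m + 1)).2 H'
  rw [← Real.norm_eq_abs]
  have hg : HasSum (fun k : ℕ => |t| ^ (m + 1) * |t| ^ k) (|t| ^ (m + 1) * (1 - |t|)⁻¹) :=
    (hasSum_geometric_of_lt_one (abs_nonneg t) (by linarith)).mul_left _
  have hle := H2.norm_le_of_bounded hg (fun k => by
    rw [Real.norm_eq_abs, abs_mul, abs_pow, abs_neg, ← pow_add, add_comm (m + 1) k]
    have := mf_choose_bound s hs m h1 h2 (k + (m + 1)) (by omega)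
    exact mul_le_of_le_one_left (by positivity) this)
  refine hle.trans ?_
  rw [mul_comm]
  apply mul_le_mul_of_nonneg_right _ (by positivity)
  rw [inv_le_comm₀ (by linarith) (by norm_num)]
  linarith

theorem mf_coef (p q k : ℕ) (hp : p.Prime) (hpq : ¬ p ∣ q) :
    ∃ c : ℤ, (p : ℝ) ^ (k + padicValNat p k.factorial) * Ring.choose ((q : ℝ) / p) k = c ∧
      ¬ (p : ℤ) ∣ c := by
  have := Fact.mk hp
  set v := padicValNat p k.factorial with hv
  have hpi : Prime (p : ℤ) := Nat.prime_iff_prime_int.1 hp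
  have hp0 : (p : ℝ) ≠ 0 := by exact_mod_cast hp.ne_zero
  obtain ⟨K, hK⟩ : p ^ v ∣ k.factorial := pow_padicValNat_dvd
  have hKp : ¬ p ∣ K := by
    rintro ⟨L, rfl⟩
    apply pow_succ_padicValNat_not_dvd (p := p) (k.factorial_ne_zero)
    rw [← hv, hK, pow_succ]
    exact ⟨L, by ring⟩
  have hK0 : (K : ℝ) ≠ 0 := by
    have : K ≠ 0 := by rintro rfl; simp at hKp
    exact_mod_cast this
  have hcop : IsCoprime (p : ℤ) (K : ℤ) :=
    Nat.isCoprime_iff_coprime.2 ((Nat.Prime.coprime_iff_not_dvd hp).2 hKp)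
  obtain ⟨r, s, hrs⟩ := hcop
  set N : ℤ := ∏ i ∈ Finset.range k, ((q : ℤ) - i * p) with hN
  have hdvd : (K : ℤ) ∣ N := by
    have h1 : N ≡ ∏ i ∈ Finset.range k, ((p : ℤ) * (q * r - i)) [ZMOD K] := by
      rw [hN]
      apply Int.ModEq.prod
      intro i _
      apply (Int.modEq_iff_dvd.2 _)
      exact ⟨-(q * s), by linear_combination (q : ℤ) * hrs⟩
    rw [Finset.prod_mul_distrib, ← mf_choose_prodZ, hK] at h1
    apply (Int.ModEq.dvd_iff h1).2
    push_cast
    exact ⟨(∏ i ∈ Finset.range k, (p : ℤ)) * p ^ v * Ring.choose ((q : ℤ) * r) k, by ring⟩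
  obtain ⟨c, hc⟩ := hdvd
  refine ⟨c, ?_, ?_⟩
  · have e := mf_choose_prod ((q : ℝ) / p) k
    have e2 : (p : ℝ) ^ k * ∏ i ∈ Finset.range k, ((q : ℝ) / p - i) = N := by
      rw [hN]
      push_cast
      have : (p : ℝ) ^ k = ∏ i ∈ Finset.range k, (p : ℝ) := by simp
      rw [this, ← Finset.prod_mul_distrib]
      apply Finset.prod_congr rfl
      intro i _
      field_simp
    rw [← e, hc, hK] at e2
    push_cast at e2
    apply mul_left_cancel₀ hK0
    rw [← e2, pow_add]; ring
  · intro hd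
    have : (p : ℤ) ∣ N := by rw [hc]; exact hd.mul_left _
    rw [hN] at this
    obtain ⟨i, _, hi⟩ := (hpi.dvd_finsetProd_iff _).1 this
    have h3 : (p : ℤ) ∣ q := by
      have := dvd_add hi (Dvd.intro_left (i : ℤ) rfl)
      simpa using this
    exact hpq (by exact_mod_cast h3)

theorem mf_root_diff (p : ℕ) (hp : 1 ≤ p) (F G : ℝ) (hF : 0 ≤ F) (hG : 0 ≤ G)
    (h : 1 / 2 ≤ G ^ p) : |F - G| ≤ 2 * |F ^ p - G ^ p| := by
  obtain ⟨n, rfl⟩ : ∃ n, p = n + 1 := ⟨p - 1, by omega⟩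
  have hG2 : 1 / 2 ≤ G ^ n := by
    rcases le_total G 1 with h1 | h1
    · calc 1 / 2 ≤ G ^ (n + 1) := h
        _ ≤ G ^ n := pow_le_pow_of_le_one hG h1 (by omega)
    · have := one_le_pow₀ h1 (n := n)
      linarith
  rcases le_total F G with hFG | hFG
  · have h3 : F ^ n ≤ G ^ n := pow_le_pow_left₀ hF hFG n
    have h4 : (G - F) * G ^ n ≤ G ^ (n + 1) - F ^ (n + 1) := by
      rw [pow_succ, pow_succ]; nlinarith
    rw [abs_sub_comm, abs_of_nonneg (by linarith), abs_sub_comm (F ^ (n + 1)),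
      abs_of_nonneg (by nlinarith)]
    nlinarith
  · have h3 : G ^ n ≤ F ^ n := pow_le_pow_left₀ hG hFG n
    have h4 : (F - G) * G ^ n ≤ F ^ (n + 1) - G ^ (n + 1) := by
      rw [pow_succ, pow_succ]; nlinarith
    rw [abs_of_nonneg (by linarith), abs_of_nonneg (by nlinarith)]
    nlinarith

set_option maxHeartbeats 1000000 in
theorem mf_hard (p q : ℕ) (hp : p.Prime) (hq : q.Prime) (hpo : Odd p)
    (hp3 : 3 ≤ p) (hpq : p < q) (x b : ℤ) (h : x ^ p = (b ^ p - 1) ^ q + 1)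
    (hb : (p : ℤ) ^ q < |b ^ p|) : False := by
  have := Fact.mk hp
  have hpq' : ¬ p ∣ q := fun hd => by
    rcases (Nat.dvd_prime hq).1 hd with h1 | h1
    · exact hp.one_lt.ne' h1
    · omega
  obtain ⟨m, hm⟩ : ∃ m, m = q / p + 1 := ⟨_, rfl⟩
  obtain ⟨v, hv⟩ : ∃ v, v = padicValNat p m.factorial := ⟨_, rfl⟩
  have hm1 : p * (m - 1) < q := by
    have h1 : p * (q / p) ≤ q := Nat.mul_div_le q p
    have h2 : p * (q / p) ≠ q := fun e => hpq' ⟨_, e.symm⟩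
    rw [hm, Nat.add_sub_cancel]; omega
  have hm2 : q ≤ p * m := by
    have := Nat.lt_mul_div_succ q hp.pos
    rw [hm]; omega
  have hm1' : 3 * (m - 1) < q := lt_of_le_of_lt (Nat.mul_le_mul_right _ hp3) hm1
  have hvm : (p - 1) * v < m := by
    rw [hv]; exact sub_one_mul_padicValNat_factorial_lt_of_ne_zero p (by rw [hm]; exact Nat.succ_ne_zero _)
  have hvm' : 2 * v < m := lt_of_le_of_lt (Nat.mul_le_mul_right _ (show 2 ≤ p - 1 by omega)) hvm
  have hexp : m + v + 2 ≤ q := by omega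
  -- reals
  have hpR : (3 : ℝ) ≤ p := by exact_mod_cast hp3
  have hp0 : (0 : ℝ) < p := by linarith
  have hbR : (p : ℝ) ^ q < |(b : ℝ) ^ p| := by exact_mod_cast hb
  have hpq1 : (1 : ℝ) ≤ (p : ℝ) ^ q := one_le_pow₀ (by linarith)
  have hb0 : (b : ℝ) ≠ 0 := by
    intro h0
    rw [h0, zero_pow hp.ne_zero, abs_zero] at hbR
    linarith
  set t : ℝ := ((b : ℝ) ^ p)⁻¹ with ht
  have htb : t * (b : ℝ) ^ p = 1 := inv_mul_cancel₀ (pow_ne_zero _ hb0)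
  have htlt : |t| * (p : ℝ) ^ q < 1 := by
    rw [ht, abs_inv]
    rw [inv_mul_lt_iff₀ (by linarith)]
    linarith
  have hqle : (q : ℝ) * 2 ≤ (p : ℝ) ^ q := by
    have h1 : q * 2 ≤ 3 ^ q := by
      have : ∀ n : ℕ, n * 2 ≤ 3 ^ n := fun n => by
        induction n with
        | zero => simp
        | succ n ih =>
          rw [pow_succ]
          rcases Nat.eq_zero_or_pos n with rfl | h0
          · norm_num
          · omega
      exact this q
    calc (q : ℝ) * 2 ≤ 3 ^ q := by exact_mod_cast h1
      _ ≤ (p : ℝ) ^ q := pow_le_pow_left₀ (by norm_num) hpR q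
  have hqt : (q : ℝ) * |t| ≤ 1 / 2 := by
    have := abs_nonneg t
    nlinarith
  have hq1 : (1 : ℝ) ≤ q := by exact_mod_cast hq.one_lt.le
  have ht2 : |t| ≤ 1 / 2 := by
    have := abs_nonneg t
    nlinarith
  have ht1 : |t| ≤ 1 := by linarith
  have ht' := abs_le.1 ht2
  set s : ℝ := (q : ℝ) / p with hs
  have hs0 : 0 ≤ s := by positivity
  have hsp : s * p = q := by rw [hs]; field_simp
  have hsm1 : (m : ℝ) - 1 ≤ s := by
    rw [hs, le_div_iff₀ hp0]
    have h1 : p * (m - 1) ≤ q := hm1.le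
    have h2 : (p : ℝ) * ((m - 1 : ℕ) : ℝ) ≤ q := by exact_mod_cast h1
    rw [Nat.cast_sub (by omega)] at h2
    push_cast at h2
    linarith
  have hsm2 : s ≤ m := by
    rw [hs, div_le_iff₀ hp0]
    have h2 : (q : ℝ) ≤ p * m := by exact_mod_cast hm2
    linarith
  have happ := mf_binom_approx s hs0 m hsm1 hsm2 t ht2
  set G : ℝ := (1 - t) ^ s with hG
  set P : ℝ := ∑ k ∈ Finset.range (m + 1), Ring.choose s k * (-t) ^ k with hP
  have hG0 : 0 ≤ G := Real.rpow_nonneg (by linarith) _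
  have hGp : G ^ p = (1 - t) ^ q := by
    rw [hG, ← Real.rpow_mul_natCast (by linarith), hsp, Real.rpow_natCast]
  have hGhalf : 1 / 2 ≤ G ^ p := by
    rw [hGp]
    have h1 := one_add_mul_le_pow (a := -t) (by linarith) q
    have h2 : (q : ℝ) * t ≤ q * |t| := mul_le_mul_of_nonneg_left (le_abs_self t) (by linarith)
    have h3 : (1 : ℝ) + -t = 1 - t := by ring
    rw [h3] at h1
    linarith
  set F : ℝ := (x : ℝ) / (b : ℝ) ^ q with hF
  have hxR : (x : ℝ) ^ p = ((b : ℝ) ^ p - 1) ^ q + 1 := by exact_mod_cast h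
  have hFp : F ^ p = (1 - t) ^ q + t ^ q := by
    have e1 : (1 - t) = ((b : ℝ) ^ p - 1) / (b : ℝ) ^ p := by
      rw [ht]; field_simp
    rw [e1, hF, div_pow, div_pow, hxR, ht, inv_pow, ← pow_mul, ← pow_mul, mul_comm q p,
      div_add' _ _ _ (pow_ne_zero _ hb0)]
    congr 1
    rw [inv_mul_cancel₀ (pow_ne_zero _ hb0)]
  have htq : |t| ^ q ≤ 1 / 2 := (pow_le_of_le_one (abs_nonneg t) ht1 hq.ne_zero).trans ht2
  have hF0 : 0 ≤ F := by
    have h1 : 0 ≤ F ^ p := by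
      rw [hFp, ← hGp]
      have := neg_abs_le (t ^ q)
      rw [abs_pow] at this
      linarith
    exact hpo.pow_nonneg_iff.1 h1
  have hFG := mf_root_diff p hp.one_lt.le F G hF0 hG0 hGhalf
  rw [hFp, hGp, add_sub_cancel_left, abs_pow] at hFG
  have htm : |t| ^ q ≤ |t| ^ (m + 1) := pow_le_pow_of_le_one (abs_nonneg t) ht1 (by omega)
  have hPF : |P - F| ≤ 4 * |t| ^ (m + 1) := by
    rw [abs_sub_comm] at happ hFG
    have : P - F = (P - G) + (G - F) := by ring
    rw [this]
    refine (abs_add_le _ _).trans ?_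
    linarith
  -- the integer
  have hcoef := fun k => mf_coef p q k hp hpq'
  choose c hc hcp using hcoef
  have hvle : ∀ k ≤ m, padicValNat p k.factorial ≤ v := fun k hk => hv ▸
    (padicValNat_dvd_iff_le (m.factorial_ne_zero)).1
      (pow_padicValNat_dvd.trans (Nat.factorial_dvd_factorial hk))
  set I : ℤ := ∑ k ∈ Finset.range (m + 1),
    (p : ℤ) ^ (m + v - (k + padicValNat p k.factorial)) * c k * (-1) ^ k * b ^ (p * (m - k))
    - p ^ (m + v) * x * b ^ (p * m - q) with hI
  have hIR : (I : ℝ) = (p : ℝ) ^ (m + v) * (b : ℝ) ^ (p * m) * (P - F) := by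
    rw [hI]
    push_cast
    rw [mul_sub, hP, Finset.mul_sum]
    congr 1
    · apply Finset.sum_congr rfl
      intro k hk
      have hk' : k ≤ m := by have := Finset.mem_range.1 hk; omega
      rw [← hc k]
      have e1 : (p : ℝ) ^ (m + v) = (p : ℝ) ^ (m + v - (k + padicValNat p k.factorial)) *
          (p : ℝ) ^ (k + padicValNat p k.factorial) := by
        rw [← pow_add]; congr 1
        have := hvle k hk'
        omega
      have e2 : (b : ℝ) ^ (p * m) = (b : ℝ) ^ (p * (m - k)) * ((b : ℝ) ^ p) ^ k := by
        rw [← pow_mul, ← pow_add, ← mul_add]; congr 2; omega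
      have e3 : (-t) ^ k * ((b : ℝ) ^ p) ^ k = (-1) ^ k := by
        rw [← mul_pow, neg_mul, htb]
      rw [e1, e2, ← e3]
      ring
    · have e2 : (b : ℝ) ^ (p * m) = (b : ℝ) ^ (p * m - q) * (b : ℝ) ^ q := by
        rw [← pow_add]; congr 1; omega
      rw [e2, hF]
      field_simp
  have hIlt : |(I : ℝ)| < 1 := by
    rw [hIR, abs_mul, abs_mul, abs_of_pos (pow_pos hp0 _)]
    have e1 : |(b : ℝ) ^ (p * m)| * |t| ^ (m + 1) = |t| := by
      rw [pow_mul, abs_pow, pow_succ, ← mul_assoc, ← mul_pow, ← abs_mul, mul_comm _ t, htb]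
      simp
    have h5 : (p : ℝ) ^ (m + v) * 9 ≤ (p : ℝ) ^ q := by
      calc (p : ℝ) ^ (m + v) * 9 ≤ (p : ℝ) ^ (m + v) * (p : ℝ) ^ 2 := by
            apply mul_le_mul_of_nonneg_left _ (by positivity)
            nlinarith
        _ = (p : ℝ) ^ (m + v + 2) := (pow_add _ _ _).symm
        _ ≤ (p : ℝ) ^ q := pow_le_pow_right₀ (by linarith) hexp
    calc (p : ℝ) ^ (m + v) * |(b : ℝ) ^ (p * m)| * |P - F|
        ≤ (p : ℝ) ^ (m + v) * |(b : ℝ) ^ (p * m)| * (4 * |t| ^ (m + 1)) :=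
          mul_le_mul_of_nonneg_left hPF (by positivity)
      _ = 4 * (p : ℝ) ^ (m + v) * (|(b : ℝ) ^ (p * m)| * |t| ^ (m + 1)) := by ring
      _ = 4 * (p : ℝ) ^ (m + v) * |t| := by rw [e1]
      _ ≤ |t| * (p : ℝ) ^ q := by
          have h6 : 0 < (p : ℝ) ^ (m + v) := by positivity
          rw [mul_comm]
          exact mul_le_mul_of_nonneg_left (by linarith) (abs_nonneg t)
      _ < 1 := htlt
  have hI0 : I = 0 := by
    have : |I| < 1 := by exact_mod_cast hIlt
    exact Int.abs_lt_one_iff.1 this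
  have hdv : (p : ℤ) ∣ c m * (-1) ^ m := by
    rw [Finset.sum_range_succ] at hI
    simp only [← hv, Nat.sub_self, pow_zero, one_mul, mul_zero, mul_one] at hI
    have e : c m * (-1) ^ m = p ^ (m + v) * x * b ^ (p * m - q) -
        ∑ k ∈ Finset.range m,
    (p : ℤ) ^ (m + v - (k + padicValNat p k.factorial)) * c k * (-1) ^ k * b ^ (p * (m - k)) := by
      linarith
    rw [e]
    apply dvd_sub
    · exact ((dvd_pow_self _ (by omega)).mul_right _).mul_right _
    · apply Finset.dvd_sum
      intro k hk
      have hk' := Finset.mem_range.1 hk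
      have := hvle k hk'.le
      exact (((dvd_pow_self _ (by omega)).mul_right _).mul_right _).mul_right _
  have hun : IsUnit ((-1 : ℤ) ^ m) := IsUnit.pow _ (by decide)
  exact hcp m ((hun.dvd_mul_right).1 hdv)

theorem mf_hyyro (p q : ℕ) (hp : p.Prime) (hq : q.Prime) (hp3 : 3 ≤ p) (hpq : p < q)
    (hpo : Odd p) (hqo : Odd q) (x y : ℤ) (hy : y ≠ 0)
    (h : x ^ p - y ^ q = 1) (hpy : (p : ℤ) ∣ y) : (p : ℤ) ^ q + p ≤ |y| := by
  obtain ⟨a, u, k, h1, h2, h3, h4, h5⟩ := mf_rel p q hp hq hpo hqo x y hy h hpy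
  have hpZ : (3 : ℤ) ≤ p := by exact_mod_cast hp3
  set n := p ^ (q - 1) with hn
  have hdvd : ((n : ℕ) : ℤ) ∣ u - 1 := by
    have hcop : Nat.Coprime q (Nat.totient n) := by
      rw [hn, Nat.totient_prime_pow hp (by omega)]
      apply Nat.Coprime.mul_right
      · exact Nat.Coprime.pow_right _ ((Nat.coprime_primes hq hp).2 (by omega))
      · apply (Nat.Prime.coprime_iff_not_dvd hq).2
        intro hd
        have := Nat.le_of_dvd (by omega) hd
        omega
    have hu : ((u : ℤ) : ZMod n) ^ q = 1 := by
      have : ((u ^ q - 1 : ℤ) : ZMod n) = 0 := by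
        rw [ZMod.intCast_zmod_eq_zero_iff_dvd]
        rw [h4, h1, hn]
        push_cast
        exact ⟨a ^ q * k, by ring⟩
      push_cast at this
      exact sub_eq_zero.1 this
    have hun : IsUnit ((u : ℤ) : ZMod n) := IsUnit.of_pow_eq_one hu (by omega)
    obtain ⟨w, hw⟩ := hun
    have hw1 : w ^ q = 1 := by
      ext; push_cast; rw [hw, hu]
    have hw2 : w ^ Nat.totient n = 1 := ZMod.pow_totient w
    have hw3 : w = 1 := by
      have h6 := Nat.dvd_gcd (orderOf_dvd_of_pow_eq_one hw1) (orderOf_dvd_of_pow_eq_one hw2)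
      rw [hcop.gcd_eq_one, Nat.dvd_one] at h6
      exact orderOf_eq_one_iff.1 h6
    rw [hw3] at hw
    rw [← ZMod.intCast_zmod_eq_zero_iff_dvd]
    push_cast
    rw [← hw]; simp
  have ha : a ≠ 0 := by rintro rfl; apply hy; rw [h3]; ring
  have hn2 : (p : ℤ) ^ 2 ≤ n := by
    rw [hn]; push_cast
    exact pow_le_pow_right₀ (by linarith) (by omega)
  have hu1 : u ≠ 1 := by
    rintro rfl
    have e : x ^ p - 1 = (x - 1) * p := by rw [← mul_geom_sum, h2]; ring
    have hxd : x ∣ p - 1 := by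
      have : x ∣ x ^ p := dvd_pow_self x hp.ne_zero
      have h7 : x ^ p - x * p = -((p : ℤ) - 1) := by linarith
      have := dvd_sub this (Dvd.intro (p : ℤ) rfl)
      rw [h7] at this
      exact (dvd_neg.1 this)
    have h8 := Int.le_of_dvd (by linarith) ((abs_dvd _ _).2 hxd)
    have h9 : (n : ℤ) ≤ |x - 1| := by
      apply Int.le_of_dvd
      · apply abs_pos.2
        rw [h1]
        exact mul_ne_zero (pow_ne_zero _ (by linarith)) (pow_ne_zero _ ha)
      · rw [dvd_abs, h1, hn]; push_cast; exact Dvd.intro _ rfl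
    have h10 : |x - 1| ≤ |x| + 1 := by
      have := abs_sub x 1
      simpa using this
    nlinarith
  have hun : (n : ℤ) + 1 ≤ u := by
    have := Int.le_of_dvd (by omega) hdvd
    linarith
  have ha1 : 1 ≤ |a| := Int.one_le_abs ha
  rw [h3, abs_mul, abs_mul, abs_of_pos h5, abs_of_pos (by linarith : (0 : ℤ) < p)]
  have e : (p : ℤ) ^ q + p = p * 1 * (n + 1) := by
    rw [hn]
    push_cast
    rw [mul_one, mul_add, mul_one, ← pow_succ']
    congr 2; have := hq.pos; omega
  rw [e]
  gcongr

theorem mf_cassels_lt (p q : ℕ) (hp : p.Prime) (hq : q.Prime) (hp3 : 3 ≤ p) (hpq : p < q)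
    (hpo : Odd p) (hqo : Odd q) (x y : ℤ) (hx : x ≠ 0) (hy : y ≠ 0)
    (h : x ^ p - y ^ q = 1) : (p : ℤ) ∣ y ∧ (q : ℤ) ∣ x := by
  have hpy := mf_easy p q hp hpo hqo hpq x y hx hy h
  refine ⟨hpy, ?_⟩
  by_contra hqx
  have hH := mf_hyyro p q hp hq hp3 hpq hpo hqo x y hy h hpy
  have h' : (-y) ^ q - (-x) ^ p = 1 := by rw [hpo.neg_pow, hqo.neg_pow]; linarith
  have hyq : ¬ (q : ℤ) ∣ -y - 1 := fun hd => hqx (by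
    have : (q : ℤ) ∣ (-x) ^ p := by
      rw [show (-x) ^ p = (-y) ^ q - 1 by linarith]
      exact hd.trans (sub_one_dvd_pow_sub_one (-y) q)
    exact (dvd_neg.1 (Int.Prime.dvd_pow' hq this)))
  have hc := mf_cop1 q hq (-y) hyq
  obtain ⟨d, hd⟩ := mf_root p hpo _ _ (-x) hc (by rw [mul_geom_sum]; linarith)
  have hb : (-d) ^ p = y + 1 := by rw [hpo.neg_pow, ← hd]; ring
  apply mf_hard p q hp hq hpo hp3 hpq x (-d)
  · rw [hb]; linarith [show y + 1 - 1 = y by ring, (congrArg (· ^ q) (show y + 1 - 1 = y by ring) : (y + 1 - 1) ^ q = y ^ q)]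
  · rw [hb]
    have hpZ : (3 : ℤ) ≤ p := by exact_mod_cast hp3
    have : |y| ≤ |y + 1| + 1 := by
      have := abs_sub (y + 1) 1
      simpa using this
    linarith

theorem mf_cassels (p q : ℕ) (hp : p.Prime) (hq : q.Prime) (hpq : p ≠ q)
    (hpo : Odd p) (hqo : Odd q) (x y : ℤ) (hx : x ≠ 0) (hy : y ≠ 0)
    (h : x ^ p - y ^ q = 1) : (p : ℤ) ∣ y ∧ (q : ℤ) ∣ x := by
  have three : ∀ r : ℕ, r.Prime → Odd r → 3 ≤ r := fun r h1 h2 => by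
    have := h1.two_le
    obtain ⟨k, hk⟩ := h2
    omega
  rcases lt_or_gt_of_ne hpq with hlt | hlt
  · exact mf_cassels_lt p q hp hq (three p hp hpo) hlt hpo hqo x y hx hy h
  · have h' : (-y) ^ q - (-x) ^ p = 1 := by rw [hpo.neg_pow, hqo.neg_pow]; linarith
    have := mf_cassels_lt q p hq hp (three q hq hqo) hlt hqo hpo (-y) (-x)
      (neg_ne_zero.2 hy) (neg_ne_zero.2 hx) h'
    exact ⟨dvd_neg.1 this.2, dvd_neg.1 this.1⟩


structure MFData (p : ℕ) [NeZero p] (R : Type*) [CommRing R] where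
  z : R
  prim : IsPrimitiveRoot z p
  s : (ZMod p)ˣ → (R ≃+* R)
  s_z : ∀ c, s c z = z ^ (c : ZMod p).val
  span : ∀ r, ∃ P : Polynomial ℤ, r = Polynomial.aeval z P
  indep : ∀ (N : ℤ) (f : (ZMod p)ˣ → ℤ),
    (N : R) ∣ ∑ c, (f c : R) * z ^ (c : ZMod p).val → ∀ c, N ∣ f c
  kron : ∀ e : R, e * s (-1) e = 1 → e ^ (2 * p) = 1

namespace MFData

variable {p : ℕ} [hp : Fact p.Prime] {R : Type*} [CommRing R] (D : MFData p R)

/-- power of `z` with exponent in `ZMod p` -/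
def zp (a : ZMod p) : R := D.z ^ a.val

theorem z_pow_mod (n : ℕ) : D.z ^ n = D.zp (n : ZMod p) := by
  rw [zp, ZMod.val_natCast]
  conv_lhs => rw [← Nat.mod_add_div n p, pow_add, pow_mul, D.prim.pow_eq_one, one_pow, mul_one]

theorem zp_add (a b : ZMod p) : D.zp (a + b) = D.zp a * D.zp b := by
  have h : D.zp a * D.zp b = D.z ^ (a.val + b.val) := by rw [zp, zp, pow_add]
  rw [h, z_pow_mod]; simp

theorem zp_zero : D.zp 0 = 1 := by simp [zp]

theorem zp_one : D.zp 1 = D.z := by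
  have := D.z_pow_mod 1
  simpa using this.symm

theorem zp_pow (a : ZMod p) (n : ℕ) : D.zp a ^ n = D.zp (n * a) := by
  rw [zp, ← pow_mul, z_pow_mod]; simp [mul_comm]

theorem s_zp (c : (ZMod p)ˣ) (a : ZMod p) : D.s c (D.zp a) = D.zp (c * a) := by
  rw [zp, map_pow, s_z]
  change D.zp _ ^ _ = _
  rw [zp_pow]; simp [mul_comm]

theorem hom_ext {S : Type*} [CommRing S] (f g : R →+* S) (h : f D.z = g D.z) (r : R) : f r = g r := by
  obtain ⟨P, rfl⟩ := D.span r
  rw [Polynomial.aeval_def, Polynomial.hom_eval₂, Polynomial.hom_eval₂, h]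
  congr 1
  exact RingHom.ext_int _ _

theorem s_mul (c d : (ZMod p)ˣ) (r : R) : D.s (c * d) r = D.s c (D.s d r) := by
  refine D.hom_ext (D.s (c * d) : R →+* R) ((D.s c : R →+* R).comp (D.s d : R →+* R)) ?_ r
  simp only [RingHom.coe_comp, Function.comp, RingHom.coe_coe]
  rw [← D.zp_one, s_zp, s_zp, s_zp]
  simp

theorem s_one (r : R) : D.s 1 r = r := by
  refine D.hom_ext (D.s 1 : R →+* R) (RingHom.id R) ?_ r
  simp only [RingHom.coe_coe, RingHom.id_apply]
  rw [← D.zp_one, s_zp]; simp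

theorem int_dvd (D : MFData p R) (N n : ℤ) (h : (N : R) ∣ n) : N ∣ n := by
  have := D.indep N (fun c => if c = 1 then n else 0) (by
    simp only [Int.cast_ite, ite_mul, Int.cast_zero, zero_mul, Finset.sum_ite_eq', Finset.mem_univ,
      if_true]
    exact h.mul_right _) 1
  simpa using this

theorem int_inj (D : MFData p R) (n : ℤ) (h : (n : R) = 0) : n = 0 := by
  have := D.int_dvd 0 n (by simp [h])
  simpa using this

/-- half system -/
def H (p : ℕ) [Fact p.Prime] : Finset (ZMod p)ˣ := Finset.univ.filter fun c => 2 * (c : ZMod p).val < p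

theorem mem_H_neg (hpo : Odd p) (c : (ZMod p)ˣ) : -c ∈ H p ↔ c ∉ H p := by
  simp only [H, Finset.mem_filter, Finset.mem_univ, true_and, Units.val_neg]
  have h0 : (c : ZMod p) ≠ 0 := c.ne_zero
  have := Fact.mk h0
  have : NeZero (c : ZMod p) := ⟨h0⟩
  rw [ZMod.val_neg_of_ne_zero]
  have h1 := ZMod.val_lt (c : ZMod p)
  obtain ⟨k, hk⟩ := hpo
  omega

theorem prod_all {M : Type*} [CommMonoid M] (hpo : Odd p) (f : (ZMod p)ˣ → M) :
    ∏ c, f c = (∏ c ∈ H p, f c⁻¹) * ∏ c ∈ H p, f (-c⁻¹) := by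
  have h1 : ∏ c, f c = ∏ c, f c⁻¹ := (Equiv.prod_comp (Equiv.inv (ZMod p)ˣ) f).symm
  rw [h1, ← Finset.prod_mul_prod_compl (H p)]
  congr 1
  refine Finset.prod_nbij' (fun c => -c) (fun c => -c) ?_ ?_ ?_ ?_ ?_
  · intro c hc
    rw [mem_H_neg hpo]
    simpa using hc
  · intro c hc
    rw [Finset.mem_compl, ← mem_H_neg hpo]
    simpa using hc
  · simp
  · simp
  · intro c _
    congr 1
    rw [inv_neg, neg_neg]

open Classical in
theorem geom_prod [IsDomain R] (x : ℤ) :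
    ∏ c : (ZMod p)ˣ, ((x : R) - D.zp c) = ((∑ i ∈ Finset.range p, x ^ i : ℤ) : R) := by
  have h1 := Polynomial.cyclotomic_eq_prod_X_sub_primitiveRoots D.prim
  have h2 := Polynomial.cyclotomic_prime R p
  have h3 := congrArg (Polynomial.eval (x : R)) (h1.symm.trans h2)
  rw [Polynomial.eval_prod, Polynomial.eval_finsetSum] at h3
  push_cast
  simp only [Polynomial.eval_sub, Polynomial.eval_X, Polynomial.eval_C, Polynomial.eval_pow] at h3
  rw [← h3]
  refine Finset.prod_nbij' (fun c => D.zp c)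
    (fun r => if h : ∃ c : (ZMod p)ˣ, D.zp c = r then h.choose else 1) ?_ ?_ ?_ ?_ ?_
  · intro c _
    rw [mem_primitiveRoots hp.out.pos]
    exact D.prim.pow_of_coprime _ (ZMod.val_coe_unit_coprime c)
  · simp
  · intro c _
    have h : ∃ d : (ZMod p)ˣ, D.zp d = D.zp c := ⟨c, rfl⟩
    simp only [h, dif_pos]
    have := h.choose_spec
    ext
    apply ZMod.val_injective
    exact D.prim.pow_inj (ZMod.val_lt _) (ZMod.val_lt _) this
  · intro r hr
    rw [mem_primitiveRoots hp.out.pos] at hr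
    obtain ⟨i, hi, hcop, rfl⟩ := D.prim.isPrimitiveRoot_iff.1 hr
    have h : ∃ d : (ZMod p)ˣ, D.zp d = D.z ^ i :=
      ⟨ZMod.unitOfCoprime i hcop, by rw [z_pow_mod]; simp⟩
    simp only [h, dif_pos]
    exact h.choose_spec
  · simp

theorem p_prod [IsDomain R] : ∏ c : (ZMod p)ˣ, (1 - D.zp c) = (p : R) := by
  have := D.geom_prod 1
  simpa using this

theorem sub_dvd_p [IsDomain R] (a b : ZMod p) (hab : a ≠ b) : D.zp a - D.zp b ∣ (p : R) := by
  have h1 : D.zp a - D.zp b = D.zp a * (1 - D.zp (b - a)) := by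
    rw [mul_sub, ← zp_add]; simp
  have hu : IsUnit (D.zp a) := by
    refine IsUnit.of_mul_eq_one (D.zp (-a)) ?_
    rw [← zp_add]; simp [zp_zero]
  rw [h1, hu.mul_left_dvd, ← D.p_prod]
  have : D.zp (b - a) = D.zp ((Units.mk0 (b - a) (sub_ne_zero.2 hab.symm) : (ZMod p)ˣ) : ZMod p) := by simp
  rw [this]
  exact Finset.dvd_prod_of_mem (fun c : (ZMod p)ˣ => 1 - D.zp c) (Finset.mem_univ _)

/-- Frobenius -/
theorem frob (D : MFData p R) (q : ℕ) (hq : q.Prime) (hpq : p ≠ q) (r : R) (h : (q : R) ∣ r ^ q) : (q : R) ∣ r := by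
  have := Fact.mk hq
  have hnu : (q : R) ∈ nonunits R := by
    intro hu
    have : ((q : ℤ) : R) ∣ ((1 : ℤ) : R) := by simpa using hu.dvd
    have := D.int_dvd _ _ this
    have h3 : q ∣ 1 := by exact_mod_cast this
    exact hq.one_lt.ne' (Nat.dvd_one.1 h3)
  have hch := CharP.quotient R q hnu
  set I := Ideal.span {(q : R)} with hI
  have hcop : Nat.Coprime q p := (Nat.coprime_primes hq hp.out).2 hpq.symm
  set c := ZMod.unitOfCoprime q hcop with hc
  have key := D.hom_ext ((frobenius (R ⧸ I) q).comp (Ideal.Quotient.mk I))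
    ((Ideal.Quotient.mk I).comp (D.s c : R →+* R)) (by
      simp only [RingHom.coe_comp, Function.comp, RingHom.coe_coe, frobenius_def]
      rw [← map_pow]
      congr 1
      rw [← D.zp_one, s_zp, zp_pow]; simp [hc]) r
  simp only [RingHom.coe_comp, Function.comp, RingHom.coe_coe, frobenius_def] at key
  rw [← map_pow, Ideal.Quotient.eq_zero_iff_mem.2 (Ideal.mem_span_singleton.2 h)] at key
  have h2 := Ideal.mem_span_singleton.1 (Ideal.Quotient.eq_zero_iff_mem.1 key.symm)
  have h3 := map_dvd (D.s c⁻¹) h2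
  rw [← s_mul, inv_mul_cancel, s_one, map_natCast] at h3
  exact h3

theorem pow_lift (D : MFData p R) (q : ℕ) (hq : q.Prime) (hpq : p ≠ q) (a b : R) (h : (q : R) ∣ a ^ q - b ^ q) :
    (q : R) ^ 2 ∣ a ^ q - b ^ q := by
  have h1 : (q : R) ∣ a - b := by
    apply D.frob q hq hpq
    obtain ⟨r, hr⟩ := exists_add_pow_prime_eq hq (a - b) b
    rw [sub_add_cancel] at hr
    have : (a - b) ^ q = (a ^ q - b ^ q) - q * ((a - b) * b * r) := by rw [hr]; ring
    rw [this]
    exact dvd_sub h (Dvd.intro _ rfl)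
  obtain ⟨k, hk⟩ := h1
  have ha : a = b + q * k := by linear_combination hk
  obtain ⟨r, hr⟩ := exists_add_pow_prime_eq hq (q * k) b
  rw [ha, add_comm b, hr, mul_pow]
  have hq2 : (q : R) ^ q = q ^ 2 * q ^ (q - 2) := by
    rw [← pow_add]; congr 1; have := hq.two_le; omega
  exact ⟨q ^ (q - 2) * k ^ q + k * b * r, by rw [hq2]; ring⟩

end MFData

namespace MFData

variable {p : ℕ} [hp : Fact p.Prime] {R : Type*} [CommRing R] (D : MFData p R)

theorem exists_char {K : Type*} [CommRing K] [IsDomain K] (ℓ : ℕ) [hl : Fact ℓ.Prime]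
    (m : R →+* K) (φ : ZMod ℓ →+* K) (xb : ZMod ℓ) (hxb : φ xb = m D.z) (h1 : m D.z ≠ 1) :
    ∃ (χ : MulChar (ZMod ℓ) R) (k : ℕ), p * k = ℓ - 1 ∧ 0 < k ∧ (∀ a, m (χ a) = φ a ^ k) ∧
      (∀ a : (ZMod ℓ)ˣ, ∃ j : ℕ, χ a = D.z ^ j) ∧
      ∃ (g : (ZMod ℓ)ˣ) (j : ℕ), χ g = D.z ^ j ∧ ¬ p ∣ j := by
  have hφ : Function.Injective φ := φ.injective
  have hxp : xb ^ p = 1 := hφ (by rw [map_pow, hxb, ← map_pow, D.prim.pow_eq_one]; simp)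
  have hx1 : xb ≠ 1 := fun h => h1 (by rw [← hxb, h, map_one])
  have hprim : IsPrimitiveRoot xb p := by
    rw [← orderOf_eq_prime hxp hx1]
    exact IsPrimitiveRoot.orderOf xb
  have hl2 := hl.out.two_le
  have hp2 := hp.out.two_le
  have hdvd : p ∣ ℓ - 1 := hprim.dvd_of_pow_eq_one _ (ZMod.pow_card_sub_one_eq_one (by
    rintro rfl; rw [zero_pow hp.out.ne_zero] at hxp; exact zero_ne_one hxp))
  obtain ⟨k, hk⟩ := hdvd
  have hk0 : 0 < k := by
    rcases Nat.eq_zero_or_pos k with h | h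
    · subst h; omega
    · exact h
  obtain ⟨g, hg⟩ := IsCyclic.exists_generator (α := (ZMod ℓ)ˣ)
  have hord : orderOf g = ℓ - 1 := by
    rw [orderOf_eq_card_of_forall_mem_zpowers hg, Nat.card_eq_fintype_card, ZMod.card_units]
  have hgk : ((g : ZMod ℓ) ^ k) ^ p = 1 := by
    rw [← pow_mul, mul_comm, ← hk, ← hord, ← Units.val_pow_eq_pow_val, pow_orderOf_eq_one]; rfl
  obtain ⟨i, hip, hi⟩ := hprim.eq_pow_of_pow_eq_one hgk
  have hpi : ¬ p ∣ i := by
    intro h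
    have : g ^ k = 1 := by
      apply Units.ext
      rw [Units.val_pow_eq_pow_val, ← hi]
      exact (hprim.pow_eq_one_iff_dvd i).2 h
    have := Nat.le_of_dvd hk0 (orderOf_dvd_of_pow_eq_one this)
    rw [hord, hk] at this
    nlinarith
  let ζ : Rˣ := Units.ofPowEqOne (D.z ^ i) p (by
    rw [← pow_mul, mul_comm, pow_mul, D.prim.pow_eq_one, one_pow]) hp.out.ne_zero
  have hζv : (ζ : R) = D.z ^ i := rfl
  have hζ : ζ ∈ rootsOfUnity (Fintype.card (ZMod ℓ)ˣ) R := by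
    rw [mem_rootsOfUnity, ZMod.card_units, hk]
    apply Units.ext
    rw [Units.val_pow_eq_pow_val, hζv, ← pow_mul, mul_comm, mul_assoc, pow_mul, D.prim.pow_eq_one, one_pow]; rfl
  let χ := MulChar.ofRootOfUnity hζ hg
  have hχg : χ g = D.z ^ i := MulChar.ofRootOfUnity_spec hζ hg
  have hpowers : ∀ a : (ZMod ℓ)ˣ, ∃ n : ℕ, a = g ^ n := fun a => by
    have := hg a
    rw [← mem_powers_iff_mem_zpowers] at this
    obtain ⟨n, hn⟩ := this
    exact ⟨n, hn.symm⟩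
  refine ⟨χ, k, hk.symm, hk0, ?_, ?_, g, i, hχg, hpi⟩
  · intro a
    by_cases ha : a = 0
    · subst ha; rw [MulChar.map_zero, map_zero, map_zero, zero_pow hk0.ne']
    · obtain ⟨n, hn⟩ := hpowers (Units.mk0 a ha)
      have hn' : a = (g : ZMod ℓ) ^ n := by
        rw [← Units.val_pow_eq_pow_val, ← hn]; rfl
      rw [hn', map_pow, hχg, map_pow, map_pow, ← hxb, ← map_pow, hi, map_pow, map_pow, ← pow_mul, ← pow_mul, mul_comm]
  · intro a
    obtain ⟨n, hn⟩ := hpowers a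
    refine ⟨i * n, ?_⟩
    rw [hn, Units.val_pow_eq_pow_val, map_pow, hχg, pow_mul]

theorem s_char {ℓ : ℕ} [Fact ℓ.Prime] (χ : MulChar (ZMod ℓ) R)
    (hχ : ∀ a : (ZMod ℓ)ˣ, ∃ j : ℕ, χ a = D.z ^ j) (c : (ZMod p)ˣ) (a : ZMod ℓ) :
    D.s c (χ a) = χ a ^ (c : ZMod p).val := by
  by_cases ha : a = 0
  · subst ha
    rw [MulChar.map_zero, map_zero, zero_pow]
    simp
  · obtain ⟨j, hj⟩ := hχ (Units.mk0 a ha)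
    have : χ a = D.z ^ j := hj
    rw [this, map_pow, D.s_z, ← pow_mul, ← pow_mul, mul_comm]

theorem s_char_neg {ℓ : ℕ} [Fact ℓ.Prime] (χ : MulChar (ZMod ℓ) R)
    (hχ : ∀ a : (ZMod ℓ)ˣ, ∃ j : ℕ, χ a = D.z ^ j) (a : ZMod ℓ) :
    D.s (-1) (χ a) = χ⁻¹ a := by
  by_cases ha : a = 0
  · subst ha
    rw [MulChar.map_zero, MulChar.map_zero, map_zero]
  · obtain ⟨j, hj⟩ := hχ (Units.mk0 a ha)
    have h1 : χ a = D.z ^ j := hj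
    have h2 : D.s (-1) (χ a) * χ a = 1 := by
      rw [h1, D.z_pow_mod, D.s_zp, ← D.zp_add]; simp [D.zp_zero]
    have h3 : χ⁻¹ a * χ a = 1 := by
      rw [← MulChar.mul_apply, inv_mul_cancel, MulChar.one_apply (Ne.isUnit ha)]
    have hu : IsUnit (χ a) := IsUnit.of_mul_eq_one _ (by rw [mul_comm]; exact h3)
    exact hu.mul_right_cancel (h2.trans h3.symm)

theorem jac_norm [IsDomain R] (hpo : Odd p) {ℓ : ℕ} [hl : Fact ℓ.Prime] (χ : MulChar (ZMod ℓ) R)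
    (hχ : ∀ a : (ZMod ℓ)ˣ, ∃ j : ℕ, χ a = D.z ^ j)
    (hg : ∃ (g : (ZMod ℓ)ˣ) (j : ℕ), χ g = D.z ^ j ∧ ¬ p ∣ j) :
    jacobiSum χ χ * D.s (-1) (jacobiSum χ χ) = ℓ := by
  obtain ⟨g, j, hgj, hpj⟩ := hg
  have h1 : D.s (-1) (jacobiSum χ χ) = jacobiSum χ⁻¹ χ⁻¹ := by
    simp only [jacobiSum, map_sum, map_mul, D.s_char_neg χ hχ]
  rw [h1]
  let f : R →+* FractionRing R := algebraMap R (FractionRing R)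
  have hf : Function.Injective f := IsFractionRing.injective R (FractionRing R)
  apply hf
  have h2 : jacobiSum χ⁻¹ χ⁻¹ = jacobiSum χ⁻¹ χ⁻¹ := rfl
  have hinv : (χ.ringHomComp f)⁻¹ = (χ⁻¹).ringHomComp f := by
    rw [inv_eq_iff_mul_eq_one]
    rw [← MulChar.ringHomComp_mul, mul_inv_cancel]
    exact MulChar.ringHomComp_one f
  have hne : χ ≠ 1 := by
    intro h
    rw [h, MulChar.one_apply g.isUnit] at hgj
    exact hpj (D.prim.dvd_of_pow_eq_one _ hgj.symm)
  have hne2 : χ * χ ≠ 1 := by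
    intro h
    have h3 : (χ * χ) g = 1 := by rw [h, MulChar.one_apply g.isUnit]
    rw [MulChar.mul_apply, hgj, ← pow_add] at h3
    have h4 := D.prim.dvd_of_pow_eq_one _ h3
    rw [← two_mul] at h4
    rcases hp.out.dvd_mul.1 h4 with h5 | h5
    · rw [Nat.prime_dvd_prime_iff_eq hp.out Nat.prime_two] at h5
      subst h5; exact absurd hpo (by decide)
    · exact hpj h5
  have hchar : ringChar (FractionRing R) = 0 := by
    rw [ringChar.eq_iff]
    have : CharZero R := charZero_of_inj_zero (fun n hn => by
      have := D.int_inj n (by exact_mod_cast hn)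
      exact_mod_cast this)
    have : CharZero (FractionRing R) := IsFractionRing.charZero R
    infer_instance
  have key := jacobiSum_mul_jacobiSum_inv (F := ZMod ℓ) (F' := FractionRing R)
    (χ := χ.ringHomComp f) (φ := χ.ringHomComp f) (by
      rw [hchar, ZMod.ringChar_zmod_n]; exact hl.out.ne_zero.symm)
    ((MulChar.ringHomComp_ne_one_iff hf).2 hne) ((MulChar.ringHomComp_ne_one_iff hf).2 hne) (by
      rw [← MulChar.ringHomComp_mul]; exact (MulChar.ringHomComp_ne_one_iff hf).2 hne2)
  rw [hinv, jacobiSum_ringHomComp, jacobiSum_ringHomComp, ZMod.card] at key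
  rw [map_mul, key, map_natCast]

theorem jac_mem {K : Type*} [CommRing K] (ℓ : ℕ) [hl : Fact ℓ.Prime]
    (m : R →+* K) (φ : ZMod ℓ →+* K) (χ : MulChar (ZMod ℓ) R)
    (hχ : ∀ a : (ZMod ℓ)ˣ, ∃ j : ℕ, χ a = D.z ^ j) (k : ℕ) (hk : p * k = ℓ - 1) (hk0 : 0 < k)
    (hm : ∀ a, m (χ a) = φ a ^ k) (c : (ZMod p)ˣ) (hc : c ∈ H p) :
    m (D.s c (jacobiSum χ χ)) = 0 := by
  have hc' : 2 * (c : ZMod p).val < p := by simpa [H] using hc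
  set n := (c : ZMod p).val
  have h1 : m (D.s c (jacobiSum χ χ)) = φ (∑ a : ZMod ℓ, a ^ (k * n) * (1 - a) ^ (k * n)) := by
    simp only [jacobiSum, map_sum, map_mul, D.s_char χ hχ, map_pow, hm]
    simp only [← pow_mul, map_sub, map_one, n]
  rw [h1]
  convert map_zero φ
  have h2 : ∀ a : ZMod ℓ, a ^ (k * n) * (1 - a) ^ (k * n) =
      ∑ i ∈ Finset.range (k * n + 1), ((-1) ^ i * ((k * n).choose i : ZMod ℓ)) * a ^ (k * n + i) := by
    intro a
    rw [sub_eq_neg_add, add_pow, Finset.mul_sum]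
    refine Finset.sum_congr rfl fun i _ => ?_
    rw [one_pow, neg_pow, pow_add]; ring
  simp only [h2]
  rw [Finset.sum_comm]
  refine Finset.sum_eq_zero fun i hi => ?_
  rw [← Finset.mul_sum, FiniteField.sum_pow_lt_card_sub_one, mul_zero]
  rw [ZMod.card, ← hk]
  have := Finset.mem_range.1 hi
  nlinarith

end MFData

namespace MFData

variable {p : ℕ} [hp : Fact p.Prime] {R : Type*} [CommRing R] (D : MFData p R)

/-- conjugate ideal -/
def sI (c : (ZMod p)ˣ) (I : Ideal R) : Ideal R := Ideal.map (D.s c) I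

theorem mem_sI (c : (ZMod p)ˣ) (I : Ideal R) (r : R) : r ∈ D.sI c I ↔ D.s c⁻¹ r ∈ I := by
  rw [sI, Ideal.mem_map_of_equiv]
  constructor
  · rintro ⟨t, ht, rfl⟩
    rwa [← D.s_mul, inv_mul_cancel, D.s_one]
  · intro h
    exact ⟨_, h, by rw [← D.s_mul, mul_inv_cancel, D.s_one]⟩

theorem sI_mul (c : (ZMod p)ˣ) (I J : Ideal R) : D.sI c (I * J) = D.sI c I * D.sI c J :=
  Ideal.map_mul _ _ _

theorem sI_sI (c d : (ZMod p)ˣ) (I : Ideal R) : D.sI c (D.sI d I) = D.sI (c * d) I := by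
  ext r
  rw [mem_sI, mem_sI, mem_sI, ← D.s_mul, mul_inv]
  rw [mul_comm]

theorem sI_span (c : (ZMod p)ˣ) (r : R) : D.sI c (Ideal.span {r}) = Ideal.span {D.s c r} := by
  rw [sI, Ideal.map_span, Set.image_singleton]

theorem sI_one (c : (ZMod p)ˣ) : D.sI c (1 : Ideal R) = 1 := by
  rw [Ideal.one_eq_top, ← Ideal.span_singleton_one, sI_span, map_one]

theorem sI_prod {ι : Type*} (c : (ZMod p)ˣ) (S : Finset ι) (f : ι → Ideal R) :
    D.sI c (∏ i ∈ S, f i) = ∏ i ∈ S, D.sI c (f i) := by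
  classical
  induction S using Finset.induction_on with
  | empty => rw [Finset.prod_empty, Finset.prod_empty, sI_one]
  | insert a S ha ih => rw [Finset.prod_insert ha, Finset.prod_insert ha, sI_mul, ih]

theorem cop_aux [IsDomain R] (I J : Ideal R) (x N : ℤ) (a b : ZMod p) (hab : a ≠ b)
    (hI : (x : R) - D.zp a ∈ I) (hJ : (x : R) - D.zp b ∈ J) (hN : IsCoprime (p : ℤ) N)
    (hNI : (N : R) ∈ I) : IsCoprime I J := by
  rw [Ideal.isCoprime_iff_sup_eq, Ideal.eq_top_iff_one]
  have h1 : (p : R) ∈ I ⊔ J := by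
    obtain ⟨t, ht⟩ := D.sub_dvd_p b a hab.symm
    rw [ht]
    apply Ideal.mul_mem_right
    have : D.zp b - D.zp a = ((x : R) - D.zp a) - ((x : R) - D.zp b) := by ring
    rw [this]
    exact Ideal.sub_mem _ (Ideal.mem_sup_left hI) (Ideal.mem_sup_right hJ)
  obtain ⟨u, v, huv⟩ := hN
  have : (1 : R) = u * p + v * N := by exact_mod_cast congrArg (Int.cast (R := R)) huv.symm
  rw [this]
  exact Ideal.add_mem _ (Ideal.mul_mem_left _ _ h1) (Ideal.mul_mem_left _ _ (Ideal.mem_sup_left hNI))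

theorem prod_sup_le {ι : Type*} (S : Finset ι) (I : Ideal R) (f : ι → Ideal R) :
    ∏ i ∈ S, (I ⊔ f i) ≤ I ⊔ ∏ i ∈ S, f i := by
  classical
  induction S using Finset.induction_on with
  | empty => simp
  | insert a S ha ih =>
    rw [Finset.prod_insert ha, Finset.prod_insert ha]
    refine (Ideal.mul_mono_right ih).trans ?_
    rw [Ideal.sup_mul, Ideal.mul_sup (f a)]
    refine sup_le (Ideal.mul_le_left.trans ?_) (sup_le ((Ideal.mul_le_right (I := f a) (J := I)).trans ?_) ?_)
    · exact (le_sup_left : I ≤ _)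
    · exact (le_sup_left : I ≤ _)
    · exact le_sup_right

theorem jac_ideal [IsDedekindDomain R] (hpo : Odd p) (L : Ideal R) [hL : L.IsPrime] (x : ℤ)
    (hxL : (x : R) - D.z ∈ L) (hpL : (p : R) ∉ L) :
    ∃ (ℓ : ℕ) (J : R), ℓ ≠ 0 ∧ J * D.s (-1) J = ℓ ∧
      Ideal.span {J} = ∏ c ∈ H p, D.sI c⁻¹ L := by
  set n : ℤ := ∑ i ∈ Finset.range p, x ^ i with hn
  have hn0 : 0 < n := Odd.geom_sum_pos hpo
  have hnL : (n : R) ∈ L := by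
    rw [hn, ← D.geom_prod, ← Finset.mul_prod_erase _ _ (Finset.mem_univ 1)]
    apply Ideal.mul_mem_right
    simpa [D.zp_one] using hxL
  obtain ⟨ℓ, hℓ⟩ := CharP.exists (R ⧸ L)
  let m : R →+* R ⧸ L := Ideal.Quotient.mk L
  have hm : ∀ r, m r = 0 ↔ r ∈ L := fun r => Ideal.Quotient.eq_zero_iff_mem
  have hmem : ∀ k : ℤ, (k : R) ∈ L ↔ (ℓ : ℤ) ∣ k := fun k => by
    rw [← hm, map_intCast, CharP.intCast_eq_zero_iff (R ⧸ L) ℓ]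
  have hℓn := (hmem n).1 hnL
  have hℓ0 : ℓ ≠ 0 := by
    rintro rfl
    rw [Nat.cast_zero, zero_dvd_iff] at hℓn; omega
  have hℓp : ℓ.Prime := (CharP.char_is_prime_or_zero (R ⧸ L) ℓ).resolve_right hℓ0
  have : Fact ℓ.Prime := ⟨hℓp⟩
  let φ : ZMod ℓ →+* R ⧸ L := ZMod.castHom (dvd_refl ℓ) (R ⧸ L)
  have hxb : φ (x : ZMod ℓ) = m D.z := by
    rw [map_intCast, ← map_intCast m, ← sub_eq_zero, ← map_sub, hm]; exact hxL
  have h1 : m D.z ≠ 1 := by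
    intro h
    apply hpL
    obtain ⟨t, ht⟩ := D.sub_dvd_p 1 0 one_ne_zero
    rw [ht]
    apply Ideal.mul_mem_right
    rw [← hm, D.zp_zero, D.zp_one, map_sub, h, map_one, sub_self]
  obtain ⟨χ, k, hk, hk0, hmχ, hχ, hg⟩ := D.exists_char ℓ m φ x hxb h1
  set J := jacobiSum χ χ
  have hJ : J * D.s (-1) J = ℓ := D.jac_norm hpo χ hχ hg
  refine ⟨ℓ, J, hℓ0, hJ, ?_⟩
  have hJm : ∀ c ∈ H p, J ∈ D.sI c⁻¹ L := fun c hc => by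
    rw [mem_sI, inv_inv, ← hm]
    exact D.jac_mem ℓ m φ χ hχ k hk hk0 hmχ c hc
  have hcopℓ : IsCoprime (p : ℤ) (ℓ : ℤ) := by
    rw [Nat.isCoprime_iff_coprime, Nat.coprime_primes hp.out hℓp]
    rintro rfl
    exact hpL (by have := (hmem p).2 (dvd_refl _); exact_mod_cast this)
  have hxc : ∀ c, (x : R) - D.zp (c : (ZMod p)ˣ) ∈ D.sI c L := fun c => by
    rw [mem_sI, map_sub, map_intCast, D.s_zp, Units.inv_mul, D.zp_one]
    exact hxL
  have hℓc : ∀ c, ((ℓ : ℤ) : R) ∈ D.sI c L := fun c => by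
    rw [mem_sI, map_intCast, hmem]
  have hcop : ∀ c d : (ZMod p)ˣ, c ≠ d → IsCoprime (D.sI c L) (D.sI d L) := fun c d hcd =>
    D.cop_aux _ _ x ℓ c d (fun h => hcd (Units.ext h)) (hxc c) (hxc d) hcopℓ (hℓc c)
  have hA : ∏ c ∈ H p, D.sI c⁻¹ L ∣ Ideal.span {J} := by
    apply Finset.prod_dvd_of_coprime
    · intro c _ d _ hcd
      exact hcop _ _ (fun h => hcd (inv_injective h))
    · intro c hc
      rw [Ideal.dvd_span_singleton]
      exact hJm c hc
  obtain ⟨B, hB⟩ := hA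
  set A := ∏ c ∈ H p, D.sI c⁻¹ L with hAdef
  have hall : A * D.sI (-1) A = ∏ c, D.sI c L := by
    rw [prod_all hpo, hAdef, sI_prod]
    congr 1
    refine Finset.prod_congr rfl fun c _ => ?_
    rw [sI_sI]; simp
  have hLle : L ≤ Ideal.span {(ℓ : R)} ⊔ Ideal.span {(x : R) - D.z} := by
    intro r hr
    obtain ⟨P, rfl⟩ := D.span r
    have h2 : (x : R) - D.z ∣ Polynomial.aeval (x : R) P - Polynomial.aeval D.z P := by
      have := Polynomial.sub_dvd_eval_sub (x : R) D.z (P.map (algebraMap ℤ R))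
      rwa [Polynomial.eval_map_algebraMap, Polynomial.eval_map_algebraMap] at this
    have h3 : Polynomial.aeval (x : R) P = ((P.eval x : ℤ) : R) := by
      exact Polynomial.aeval_algebraMap_apply_eq_algebraMap_eval x P
    have h4 : (ℓ : ℤ) ∣ P.eval x := by
      rw [← hmem, ← h3]
      have h5 : Polynomial.aeval (x : R) P - Polynomial.aeval D.z P ∈ L := Ideal.mem_of_dvd _ h2 hxL
      have h6 := Ideal.add_mem _ h5 hr
      rwa [sub_add_cancel] at h6
    have h6 : Polynomial.aeval D.z P = Polynomial.aeval (x : R) P - (Polynomial.aeval (x : R) P - Polynomial.aeval D.z P) := by ring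
    rw [h6]
    refine Ideal.sub_mem _ (Ideal.mem_sup_left ?_) (Ideal.mem_sup_right (Ideal.mem_span_singleton.2 h2))
    rw [Ideal.mem_span_singleton, h3]
    obtain ⟨w, hw⟩ := h4
    exact ⟨w, by rw [hw]; push_cast; rfl⟩
  have hle : ∏ c, D.sI c L ≤ Ideal.span {(ℓ : R)} := by
    calc ∏ c, D.sI c L ≤ ∏ c : (ZMod p)ˣ, (Ideal.span {(ℓ : R)} ⊔ Ideal.span {(x : R) - D.zp c}) := by
          refine Finset.prod_le_prod' fun c _ => ?_
          rw [sI]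
          refine (Ideal.map_mono hLle).trans ?_
          rw [Ideal.map_sup, Ideal.map_span, Ideal.map_span, Set.image_singleton, Set.image_singleton,
            map_natCast, map_sub, map_intCast, D.s_z]
          exact le_rfl
      _ ≤ _ := prod_sup_le _ _ _
      _ ≤ _ := by
          rw [Ideal.prod_span_singleton, D.geom_prod]
          refine sup_le le_rfl ?_
          rw [Ideal.span_singleton_le_span_singleton]
          obtain ⟨w, hw⟩ := hℓn
          exact ⟨w, by rw [← hn, hw]; push_cast; rfl⟩
  have hℓeq : Ideal.span {(ℓ : R)} = (A * D.sI (-1) A) * (B * D.sI (-1) B) := by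
    rw [← hJ, ← Ideal.span_singleton_mul_span_singleton, ← D.sI_span, hB, sI_mul]
    ring
  have hℓne : Ideal.span {(ℓ : R)} ≠ 0 := by
    rw [Ne, Ideal.zero_eq_bot, Ideal.span_singleton_eq_bot]
    intro h
    exact hℓ0 (by exact_mod_cast D.int_inj ℓ (by exact_mod_cast h))
  have h7 : (A * D.sI (-1) A) * (B * D.sI (-1) B) ∣ A * D.sI (-1) A := by
    rw [← hℓeq, hall, Ideal.dvd_iff_le]; exact hle
  have hAA : A * D.sI (-1) A ≠ 0 := fun h => hℓne (by rw [hℓeq, h, zero_mul])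
  have h8 : B * D.sI (-1) B ∣ 1 := by
    rw [← mul_dvd_mul_iff_left hAA, mul_one]; exact h7
  have h9 : B = 1 := by
    have : B ∣ 1 := (Dvd.intro _ rfl).trans h8
    rw [Ideal.one_eq_top]; exact Ideal.isUnit_iff.1 (isUnit_of_dvd_one this)
  rw [hB, h9, mul_one]

end MFData

namespace MFData

variable {p : ℕ} [hp : Fact p.Prime] {R : Type*} [CommRing R] (D : MFData p R)

theorem ideal_ind [IsDedekindDomain R] (hpo : Odd p) (x : ℤ) (I : Ideal R) (hI : I ≠ 0)
    (h : ∀ L : Ideal R, L.IsPrime → L ∣ I → (x : R) - D.z ∈ L ∧ (p : R) ∉ L) :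
    ∃ (β : R) (N : ℤ), β * D.s (-1) β = N ∧ Ideal.span {β} = ∏ c ∈ H p, D.sI c⁻¹ I := by
  revert hI h
  refine UniqueFactorizationMonoid.induction_on_prime I ?_ ?_ ?_
  · intro h; exact absurd rfl h
  · intro J hJ _ _
    rw [Ideal.isUnit_iff, ← Ideal.one_eq_top] at hJ
    subst hJ
    refine ⟨1, 1, by simp, ?_⟩
    rw [Finset.prod_congr rfl (fun c _ => D.sI_one _), Finset.prod_const_one, Ideal.one_eq_top,
      Ideal.span_singleton_one]
  · intro J L hJ hL ih hne h
    have hLp : L.IsPrime := Ideal.isPrime_of_prime hL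
    obtain ⟨h1, h2⟩ := h L hLp (Dvd.intro _ rfl)
    obtain ⟨ℓ, j, _, hj, hjs⟩ := D.jac_ideal hpo L x h1 h2
    obtain ⟨β, N, hβ, hβs⟩ := ih hJ fun L' hL' hd => h L' hL' (hd.mul_left _)
    refine ⟨j * β, ℓ * N, ?_, ?_⟩
    · rw [map_mul]
      push_cast
      rw [← hj, ← hβ]; ring
    · rw [← Ideal.span_singleton_mul_span_singleton, hjs, hβs, ← Finset.prod_mul_distrib]
      refine Finset.prod_congr rfl fun c _ => ?_
      rw [sI_mul]

theorem unit_root [IsDomain R] (q : ℕ) (hq : q.Prime) (hqo : Odd q) (hpq : p ≠ q) (e : R) (N M : ℤ) (hM : M ≠ 0)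
    (hu : IsUnit e) (h : (N : R) * (e * D.s (-1) e) = M) : ∃ t : R, t ^ q = e := by
  have hu2 : IsUnit (e * D.s (-1) e) := hu.mul (hu.map (D.s (-1)))
  have h1 : N ∣ M := D.int_dvd _ _ (Dvd.intro _ h)
  have h2 : M ∣ N := D.int_dvd _ _ (by rw [← h]; exact (hu2.mul_right_dvd).2 dvd_rfl)
  have hMR : (M : R) ≠ 0 := fun hh => hM (D.int_inj _ hh)
  have h3 : (e * D.s (-1) e) ^ 2 = 1 := by
    rcases Int.natAbs_eq_natAbs_iff.1 (Int.natAbs_eq_of_dvd_dvd h1 h2) with h4 | h4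
    · rw [h4] at h
      have : e * D.s (-1) e = 1 := mul_left_cancel₀ hMR (by rw [h, mul_one])
      rw [this, one_pow]
    · rw [h4] at h
      have : e * D.s (-1) e = -1 := mul_left_cancel₀ hMR (by
        push_cast at h
        rw [mul_neg, mul_one]
        linear_combination -h)
      rw [this]; ring
  have h5 : (e ^ 2) ^ (2 * p) = 1 := D.kron _ (by rw [map_pow, ← mul_pow, h3])
  have hcop : q.Coprime (4 * p) := by
    refine Nat.Coprime.mul_right ?_ ((Nat.coprime_primes hq hp.out).2 hpq.symm)
    have : Nat.Coprime q 2 := hqo.coprime_two_right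
    exact Nat.Coprime.pow_right 2 this
  obtain ⟨m, _, hm⟩ := Nat.exists_mul_mod_eq_one_of_coprime hcop (by have := hp.out.pos; omega)
  refine ⟨e ^ m, ?_⟩
  rw [← pow_mul, mul_comm, ← Nat.mod_add_div (q * m) (4 * p), hm, pow_add, pow_one, pow_mul]
  have : e ^ (4 * p) = 1 := by rw [← h5, ← pow_mul]; congr 1; ring
  rw [this, one_pow, mul_one]

theorem exists_gamma [IsDedekindDomain R] (hpo : Odd p) (q : ℕ) (hq : q.Prime) (hqo : Odd q) (hpq : p ≠ q)
    (x u k : ℤ) (hpx : (p : ℤ) ∣ x - 1) (hsum : ∑ i ∈ Finset.range p, x ^ i = p * u ^ q)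
    (huk : u ^ q = 1 + (x - 1) * k) (hu : 0 < u) :
    ∃ α γ : R, α * (1 - D.z) = x - D.z ∧ ∏ c ∈ H p, D.s c⁻¹ α = γ ^ q ∧
      γ ^ q * D.s (-1) γ ^ q = (u : R) ^ q := by
  obtain ⟨w, hw⟩ := hpx
  obtain ⟨t, ht⟩ : 1 - D.z ∣ (p : R) := by
    have := D.sub_dvd_p 0 1 zero_ne_one
    rwa [D.zp_zero, D.zp_one] at this
  let α : R := t * w + 1
  have hα : α * (1 - D.z) = x - D.z := by
    have : (x : R) - 1 = p * w := by exact_mod_cast congrArg (Int.cast (R := R)) hw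
    simp only [α]
    linear_combination -this - (w : R) * ht
  have hαc : ∀ c, D.s c α * (1 - D.zp c) = x - D.zp c := fun c => by
    have := congrArg (D.s c) hα
    rw [map_mul, map_sub, map_sub, map_one, map_intCast, D.s_z] at this
    exact this
  have hp0 : (p : R) ≠ 0 := fun hh => hp.out.ne_zero (by exact_mod_cast D.int_inj p (by exact_mod_cast hh))
  have hu0 : u ≠ 0 := hu.ne'
  have hprod : ∏ c, D.s c α = (u : R) ^ q := by
    apply mul_right_cancel₀ hp0
    rw [← D.p_prod, ← Finset.prod_mul_distrib]
    simp only [hαc]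
    rw [D.geom_prod, hsum, D.p_prod]; push_cast; ring
  have hcop : IsCoprime (p : ℤ) (u ^ q) := ⟨-(w * k), 1, by rw [huk, hw]; ring⟩
  have hmemx : ∀ c, (x : R) - D.zp (c : (ZMod p)ˣ) ∈ Ideal.span {D.s c α} := fun c => by
    rw [Ideal.mem_span_singleton, ← hαc]; exact Dvd.intro _ rfl
  have hmemu : ∀ c : (ZMod p)ˣ, ((u ^ q : ℤ) : R) ∈ Ideal.span {D.s c α} := fun c => by
    rw [Ideal.mem_span_singleton, Int.cast_pow, ← hprod]; exact Finset.dvd_prod_of_mem _ (Finset.mem_univ c)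
  obtain ⟨I, hI⟩ := Finset.exists_eq_pow_of_mul_eq_pow_of_coprime (R := Ideal R) (n := q) (c := Ideal.span {(u : R)})
    (s := Finset.univ) (f := fun c : (ZMod p)ˣ => Ideal.span {D.s c α})
    (fun c _ d _ hcd => D.cop_aux _ _ x (u ^ q) c d (fun h => hcd (Units.ext h)) (hmemx c) (hmemx d) hcop (hmemu c))
    (by rw [Ideal.prod_span_singleton, hprod, Ideal.span_singleton_pow]) 1 (Finset.mem_univ _)
  simp only [D.s_one] at hI
  have huR : (u : R) ≠ 0 := fun hh => hu0 (D.int_inj u hh)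
  have hα0 : α ≠ 0 := by
    rintro h
    apply pow_ne_zero q huR
    rw [← hprod, ← Finset.mul_prod_erase _ _ (Finset.mem_univ 1), h]; simp
  have hI0 : I ≠ 0 := by
    rintro rfl
    rw [zero_pow hq.ne_zero, Ideal.zero_eq_bot, Ideal.span_singleton_eq_bot] at hI
    exact hα0 hI
  obtain ⟨β, N, hβ, hβs⟩ := D.ideal_ind hpo x I hI0 (fun L hL hd => by
    have hαL : Ideal.span {α} ≤ L := by
      rw [hI, ← Ideal.dvd_iff_le]; exact hd.trans (dvd_pow_self _ hq.ne_zero)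
    have h1 := hαL (by simpa [D.zp_one, D.s_one] using hmemx 1)
    have h2 := hαL (by simpa only [D.s_one] using hmemu 1)
    refine ⟨h1, fun h3 => hL.ne_top ?_⟩
    obtain ⟨a, b, hab⟩ := hcop
    rw [Ideal.eq_top_iff_one]
    have : (1 : R) = a * p + b * (u ^ q : ℤ) := by exact_mod_cast congrArg (Int.cast (R := R)) hab.symm
    rw [this]
    exact Ideal.add_mem _ (Ideal.mul_mem_left _ _ h3) (Ideal.mul_mem_left _ _ h2))
  have hass : Associated (β ^ q) (∏ c ∈ H p, D.s c⁻¹ α) := by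
    rw [← Ideal.span_singleton_eq_span_singleton, ← Ideal.span_singleton_pow, hβs, ← Ideal.prod_span_singleton,
      ← Finset.prod_pow]
    refine Finset.prod_congr rfl fun c _ => ?_
    rw [← D.sI_span, hI, sI, sI, Ideal.map_pow]
  obtain ⟨ε, hε⟩ := hass
  have hAA : (∏ c ∈ H p, D.s c⁻¹ α) * D.s (-1) (∏ c ∈ H p, D.s c⁻¹ α) = (u : R) ^ q := by
    rw [← hprod, prod_all hpo, map_prod]
    congr 1
    refine Finset.prod_congr rfl fun c _ => ?_
    rw [← D.s_mul]; simp
  obtain ⟨t, ht⟩ := D.unit_root q hq hqo hpq ε (N ^ q) (u ^ q) (pow_ne_zero _ hu0) ε.isUnit (by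
    push_cast
    rw [← hAA, ← hε, ← hβ, map_mul, map_pow]; ring)
  refine ⟨α, β * t, hα, ?_, ?_⟩
  · rw [mul_pow, ht, hε]
  · rw [← map_pow, mul_pow, ht, hε, hAA]

end MFData

namespace MFData

variable {p : ℕ} [hp : Fact p.Prime] {R : Type*} [CommRing R] (D : MFData p R)

theorem prod_lin {ι : Type*} (S : Finset ι) (x : R) (t : ι → R) :
    x ^ 2 ∣ ∏ i ∈ S, (1 - x * t i) - (1 - x * ∑ i ∈ S, t i) := by
  classical
  induction S using Finset.induction_on with
  | empty => simp
  | insert a S ha ih =>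
    rw [Finset.prod_insert ha, Finset.sum_insert ha]
    obtain ⟨w, hw⟩ := ih
    exact ⟨(1 - x * t a) * w + t a * ∑ i ∈ S, t i, by linear_combination (1 - x * t a) * hw⟩

theorem sum_all {M : Type*} [AddCommMonoid M] (hpo : Odd p) (f : (ZMod p)ˣ → M) :
    ∑ c, f c = (∑ c ∈ H p, f c⁻¹) + ∑ c ∈ H p, f (-c⁻¹) :=
  prod_all (M := Multiplicative M) hpo f

theorem q_sq_dvd (D : MFData p R) [IsDedekindDomain R] (hpo : Odd p) (q : ℕ) (hq : q.Prime) (hqo : Odd q) (hpq : p ≠ q)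
    (x u k : ℤ) (hqx : (q : ℤ) ∣ x) (hpx : (p : ℤ) ∣ x - 1)
    (hsum : ∑ i ∈ Finset.range p, x ^ i = p * u ^ q)
    (huk : u ^ q = 1 + (x - 1) * k) (hu : 0 < u) : (q : ℤ) ^ 2 ∣ x := by
  obtain ⟨α, γ, hα, hγ, hγu⟩ := D.exists_gamma hpo q hq hqo hpq x u k hpx hsum huk hu
  have hαc : ∀ c, D.s c α * (1 - D.zp c) = x - D.zp c := fun c => by
    have := congrArg (D.s c) hα
    rw [map_mul, map_sub, map_sub, map_one, map_intCast, D.s_z] at this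
    exact this
  have hqR : (q : R) ≠ 0 := fun hh => hq.ne_zero (by exact_mod_cast D.int_inj q (by exact_mod_cast hh))
  have hp0 : (p : R) ≠ 0 := fun hh => hp.out.ne_zero (by exact_mod_cast D.int_inj p (by exact_mod_cast hh))
  have hzz : ∀ a : ZMod p, D.zp a * D.zp (-a) = 1 := fun a => by
    rw [← D.zp_add, add_neg_cancel, D.zp_zero]
  set γ' := D.s (-1) γ with hγ'
  set A : R := ∏ c ∈ H p, (1 - (x : R) * D.zp (-((c⁻¹ : (ZMod p)ˣ) : ZMod p))) with hA
  set A' : R := ∏ c ∈ H p, (1 - (x : R) * D.zp ((c⁻¹ : (ZMod p)ˣ) : ZMod p)) with hA'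
  set V : R := ∏ c ∈ H p, (1 - D.zp (-((c⁻¹ : (ZMod p)ˣ) : ZMod p))) with hV
  set W : R := ∏ c ∈ H p, (-D.zp ((c⁻¹ : (ZMod p)ˣ) : ZMod p)) with hW
  set W' : R := ∏ c ∈ H p, (-D.zp (-((c⁻¹ : (ZMod p)ˣ) : ZMod p))) with hW'
  have hWW : W * W' = 1 := by
    rw [hW, hW', ← Finset.prod_mul_distrib]
    refine Finset.prod_eq_one fun c _ => ?_
    rw [neg_mul_neg, hzz]
  have e1 : γ ^ q * (W * V) = W * A := by
    rw [← hγ, hW, hV, hA, ← Finset.prod_mul_distrib, ← Finset.prod_mul_distrib, ← Finset.prod_mul_distrib]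
    refine Finset.prod_congr rfl fun c _ => ?_
    have h1 := hαc c⁻¹
    have h2 := hzz ((c⁻¹ : (ZMod p)ˣ) : ZMod p)
    linear_combination h1 + (D.s c⁻¹ α - x) * h2
  have e1' : γ ^ q * V = A := by
    linear_combination W' * e1 - (γ ^ q * V - A) * hWW
  have e2 : γ' ^ q * V = W' * A' := by
    rw [hγ', ← map_pow, ← hγ, hW', hV, hA', map_prod, ← Finset.prod_mul_distrib, ← Finset.prod_mul_distrib]
    refine Finset.prod_congr rfl fun c _ => ?_
    have h1 := hαc (-c⁻¹)
    have h2 := hzz ((c⁻¹ : (ZMod p)ˣ) : ZMod p)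
    rw [Units.val_neg] at h1
    rw [← D.s_mul, neg_one_mul]
    linear_combination h1 - x * h2
  have hV0 : V ≠ 0 := by
    rw [hV, Finset.prod_ne_zero_iff]
    intro c _ h
    have h3 := D.sub_dvd_p 0 (-((c⁻¹ : (ZMod p)ˣ) : ZMod p)) (by
      rw [Ne, zero_eq_neg]; exact (c⁻¹).ne_zero)
    rw [D.zp_zero, h, zero_dvd_iff] at h3
    exact hp0 h3
  have e3 : A * γ' ^ q = A' * (W' * γ ^ q) := by
    apply mul_right_cancel₀ hV0
    linear_combination A * e2 - A' * W' * e1'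
  obtain ⟨ρ, hρ⟩ : ∃ ρ : R, ρ ^ q = W' := by
    refine ⟨∏ c ∈ H p, (-D.zp (-((c⁻¹ : (ZMod p)ˣ) : ZMod p) * (q : ZMod p)⁻¹)), ?_⟩
    rw [hW', ← Finset.prod_pow]
    refine Finset.prod_congr rfl fun c _ => ?_
    rw [hqo.neg_pow, D.zp_pow]
    have : (q : ZMod p) ≠ 0 := by
      rw [Ne, ZMod.natCast_eq_zero_iff, Nat.prime_dvd_prime_iff_eq hp.out hq]; exact hpq
    congr 2
    rw [mul_comm, mul_assoc, inv_mul_cancel₀ this, mul_one]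
  rw [← hρ, ← mul_pow] at e3
  obtain ⟨x', hx'⟩ := hqx
  have hxR : (x : R) = q * x' := by rw [hx']; push_cast; ring
  have lin : ∀ t : (ZMod p)ˣ → R, (q : R) ^ 2 ∣ ∏ i ∈ H p, (1 - (x : R) * t i) - (1 - (x : R) * ∑ i ∈ H p, t i) := fun t => by
    refine dvd_trans ?_ (prod_lin (H p) (x : R) t)
    rw [hxR, mul_pow]; exact Dvd.intro _ rfl
  have lin1 : ∀ t : (ZMod p)ˣ → R, (q : R) ∣ ∏ i ∈ H p, (1 - (x : R) * t i) - 1 := fun t => by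
    obtain ⟨w, hw⟩ := lin t
    refine ⟨q * w - x' * ∑ i ∈ H p, t i, ?_⟩
    rw [hxR] at hw ⊢
    linear_combination hw
  have hAq : (q : R) ∣ A - 1 := lin1 _
  have hAq' : (q : R) ∣ A' - 1 := lin1 _
  have h4 : (q : R) ∣ γ' ^ q - (ρ * γ) ^ q := by
    have : γ' ^ q - (ρ * γ) ^ q = (A' - 1) * (ρ * γ) ^ q - (A - 1) * γ' ^ q := by
      linear_combination e3
    rw [this]
    exact dvd_sub (hAq'.mul_right _) (hAq.mul_right _)
  have h5 := D.pow_lift q hq hpq _ _ h4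
  have h6 : (q : R) ^ 2 ∣ (A - A') * (u : R) ^ q := by
    have : (A - A') * (u : R) ^ q = -(γ' ^ q - (ρ * γ) ^ q) * (A' * γ ^ q) := by
      rw [← hγu]
      linear_combination γ ^ q * e3
    rw [this]
    exact (h5.neg_right).mul_right _
  have hqu : IsCoprime ((q : ℤ) ^ 2) (u ^ q) := by
    apply IsCoprime.pow
    rw [Prime.coprime_iff_not_dvd (Nat.prime_iff_prime_int.1 hq)]
    intro h
    have h7 : (q : ℤ) ∣ ∑ i ∈ Finset.range p, x ^ i := by
      rw [hsum]; exact (h.trans (dvd_pow_self _ hq.ne_zero)).mul_left _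
    obtain ⟨n, hn⟩ := Nat.exists_eq_succ_of_ne_zero hp.out.ne_zero
    rw [hn, Finset.sum_range_succ', pow_zero] at h7
    have h8 : (q : ℤ) ∣ 1 := by
      refine (dvd_add_right (Finset.dvd_sum fun i _ => ?_)).1 h7
      rw [hx']; exact (Dvd.intro _ rfl : (q : ℤ) ∣ q * x').trans (dvd_pow_self _ (Nat.succ_ne_zero _))
    exact (Nat.prime_iff_prime_int.1 hq).not_isUnit (isUnit_of_dvd_one h8)
  have h7 : (q : R) ^ 2 ∣ A - A' := by
    obtain ⟨a, b, hab⟩ := hqu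
    have h8 : (1 : R) = a * q ^ 2 + b * u ^ q := by exact_mod_cast congrArg (Int.cast (R := R)) hab.symm
    have h9 : A - A' = (A - A') * a * q ^ 2 + b * ((A - A') * u ^ q) := by linear_combination (A - A') * h8
    rw [h9]
    exact dvd_add (Dvd.intro_left _ rfl) (h6.mul_left _)
  have h8 : (q : R) ∣ (x' : R) * (∑ c ∈ H p, D.zp ((c⁻¹ : (ZMod p)ˣ) : ZMod p) - ∑ c ∈ H p, D.zp (-((c⁻¹ : (ZMod p)ˣ) : ZMod p))) := by
    obtain ⟨a, ha⟩ := lin (fun c => D.zp (-((c⁻¹ : (ZMod p)ˣ) : ZMod p)))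
    obtain ⟨b, hb⟩ := lin (fun c => D.zp ((c⁻¹ : (ZMod p)ˣ) : ZMod p))
    obtain ⟨c, hc⟩ := h7
    rw [← hA] at ha
    rw [← hA'] at hb
    rw [hxR] at ha hb
    refine ⟨c - a + b, mul_left_cancel₀ hqR ?_⟩
    linear_combination hc - ha + hb
  have h9 : (q : ℤ) ∣ (fun c : (ZMod p)ˣ => x' * (if c⁻¹ ∈ H p then 1 else -1)) 1 := by
    refine D.indep (q : ℤ) (fun c : (ZMod p)ˣ => x' * (if c⁻¹ ∈ H p then 1 else -1)) ?_ 1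
    rw [sum_all hpo]
    push_cast
    convert h8 using 1
    rw [mul_sub, sub_eq_add_neg, Finset.mul_sum, Finset.mul_sum, ← Finset.sum_neg_distrib]
    congr 1
    · refine Finset.sum_congr rfl fun c hc => ?_
      rw [inv_inv, if_pos hc, mul_one]; rw [Units.val_inv_eq_inv_val, zp]
    · refine Finset.sum_congr rfl fun c hc => ?_
      have : (-c⁻¹)⁻¹ ∉ H p := by
        rw [inv_neg, inv_inv, mem_H_neg hpo]; exact not_not.2 hc
      rw [if_neg this, mul_neg, mul_one, neg_mul]; rw [Units.val_inv_eq_inv_val, zp]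
  have h10 : (q : ℤ) ∣ x' := by
    dsimp only at h9
    split_ifs at h9
    · simpa using h9
    · simpa using h9
  rw [hx', pow_two]
  exact mul_dvd_mul_left _ h10

end MFData


open NumberField in
theorem mf_data (p : ℕ) [hp : Fact p.Prime] (hpo : Odd p) (K : Type) [Field K] [NumberField K]
    [IsCyclotomicExtension {p} ℚ K] : Nonempty (MFData p (𝓞 K)) := by
  have hζ := IsCyclotomicExtension.zeta_spec p ℚ K
  set ζ : K := IsCyclotomicExtension.zeta p ℚ K
  let z : 𝓞 K := hζ.toInteger
  have hz : IsPrimitiveRoot z p := hζ.toInteger_isPrimitiveRoot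
  let σ : (ZMod p)ˣ → Gal(K/ℚ) := fun c => (IsCyclotomicExtension.Rat.galEquivZMod p K).symm c
  let s : (ZMod p)ˣ → (𝓞 K ≃+* 𝓞 K) := fun c => RingOfIntegers.mapRingEquiv (σ c).toRingEquiv
  have hs : ∀ c r, ((s c r : 𝓞 K) : K) = σ c (r : K) := fun c r => rfl
  have hsz : ∀ c, s c z = z ^ (c : ZMod p).val := fun c => by
    apply RingOfIntegers.ext
    refine Eq.trans ?_ (map_pow (algebraMap (𝓞 K) K) z _).symm
    rw [hs]
    have := IsCyclotomicExtension.Rat.galEquivZMod_apply_of_pow_eq p K (σ c) (x := ζ) hζ.pow_eq_one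
    rw [show (IsCyclotomicExtension.Rat.galEquivZMod p K) (σ c) = c from
      MulEquiv.apply_symm_apply _ c] at this
    exact this
  have hspan : ∀ r : 𝓞 K, ∃ P : Polynomial ℤ, r = Polynomial.aeval z P := fun r => by
    have := hζ.integralPowerBasis.exists_eq_aeval' r
    rwa [hζ.integralPowerBasis_gen] at this
  refine ⟨⟨z, hz, s, hsz, hspan, ?_, ?_⟩⟩
  · intro N f hN c₀
    let b := hζ.integralPowerBasis
    have hdim : b.dim = p - 1 := by
      rw [hζ.integralPowerBasis_dim, Nat.totient_prime hp.out]
    have hvpos : ∀ c : (ZMod p)ˣ, 0 < (c : ZMod p).val := fun c => by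
      rw [Nat.pos_iff_ne_zero, Ne, ZMod.val_eq_zero]; exact c.ne_zero
    have hvlt : ∀ c : (ZMod p)ˣ, (c : ZMod p).val < p := fun c => ZMod.val_lt _
    let i : (ZMod p)ˣ → Fin b.dim := fun c => ⟨(c : ZMod p).val - 1, by
      have := hvpos c; have := hvlt c; omega⟩
    have hinj : Function.Injective i := by
      intro c d h
      have h1 : (c : ZMod p).val - 1 = (d : ZMod p).val - 1 := congrArg Fin.val h
      have := hvpos c; have := hvpos d
      exact Units.ext (ZMod.val_injective p (by omega))
    have hsum : ∑ c, (f c : 𝓞 K) * z ^ (c : ZMod p).val = z * ∑ c, f c • b.basis (i c) := by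
      rw [Finset.mul_sum]
      refine Finset.sum_congr rfl fun c _ => ?_
      rw [b.basis_eq_pow, hζ.integralPowerBasis_gen, zsmul_eq_mul]
      obtain ⟨n, hn⟩ := Nat.exists_eq_succ_of_ne_zero (hvpos c).ne'
      have : (i c : ℕ) = n := by simp only [i]; omega
      rw [this, hn, pow_succ]; ring
    rw [hsum, (hz.isUnit hp.out.ne_zero).dvd_mul_left] at hN
    obtain ⟨t, ht⟩ := hN
    have h2 := congrArg (fun r => b.basis.repr r (i c₀)) ht
    simp only [map_sum, map_zsmul, Module.Basis.repr_self] at h2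
    rw [← zsmul_eq_mul, map_zsmul] at h2
    simp only [Finsupp.coe_finsetSum, Finset.sum_apply, Finsupp.coe_smul, Pi.smul_apply, Finsupp.single_apply,
      hinj.eq_iff, smul_eq_mul, mul_ite, mul_one, mul_zero, Finset.sum_ite_eq', Finset.mem_univ, if_true] at h2
    exact ⟨_, h2⟩
  · intro e he
    have hnorm : ∀ φ : K →+* ℂ, ‖φ (e : K)‖ = 1 := by
      intro φ
      let ψ : 𝓞 K →+* ℂ := φ.comp (algebraMap (𝓞 K) K)
      have hψz : (ψ z) ^ p = 1 := by rw [← map_pow, hz.pow_eq_one, map_one]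
      have h1 : ‖ψ z‖ = 1 := Complex.norm_eq_one_of_pow_eq_one hψz hp.out.ne_zero
      have h2 : ψ (s (-1) z) = (starRingEnd ℂ) (ψ z) := by
        rw [← Complex.inv_eq_conj h1]
        apply eq_inv_of_mul_eq_one_left
        rw [hsz, ← map_mul, ← pow_succ]
        have : p ∣ ((-1 : (ZMod p)ˣ) : ZMod p).val + 1 := by
          rw [← ZMod.natCast_eq_zero_iff]; push_cast; simp
        rw [(hz.pow_eq_one_iff_dvd _).2 this, map_one]
      have h3 : ∀ r, ψ (s (-1) r) = (starRingEnd ℂ) (ψ r) := by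
        intro r
        obtain ⟨P, rfl⟩ := hspan r
        have h4 : ((ψ.comp (s (-1) : 𝓞 K →+* 𝓞 K))) (Polynomial.aeval z P) = (((starRingEnd ℂ).comp ψ)) (Polynomial.aeval z P) := by
          rw [Polynomial.aeval_def, Polynomial.hom_eval₂, Polynomial.hom_eval₂]
          congr 1
          exact RingHom.ext_int _ _
        exact h4
      have h5 := congrArg ψ he
      rw [map_mul, h3, map_one, Complex.mul_conj'] at h5
      have h6 : ‖ψ e‖ ^ 2 = 1 := by exact_mod_cast h5
      have h7 : ‖ψ e‖ = 1 := by
        have := norm_nonneg (ψ e)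
        nlinarith
      exact h7
    obtain ⟨n, hn, hen⟩ := NumberField.Embeddings.pow_eq_one_of_norm_eq_one K ℂ (RingOfIntegers.isIntegral_coe e) hnorm
    obtain ⟨r, hr⟩ := hζ.exists_neg_pow_of_isOfFinOrder hpo (isOfFinOrder_iff_pow_eq_one.2 ⟨n, hn, hen⟩)
    apply RingOfIntegers.ext
    refine Eq.trans (map_pow (algebraMap (𝓞 K) K) e _) (Eq.trans ?_ (map_one (algebraMap (𝓞 K) K)).symm)
    have h8 : (algebraMap (𝓞 K) K) e ^ (2 * p) = 1 := by
      rw [hr, ← pow_mul, mul_comm, pow_mul, pow_mul, neg_sq, ← pow_mul ζ, mul_comm 2 p, pow_mul ζ, hζ.pow_eq_one, one_pow, one_pow]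
    exact h8

theorem mf_half (p q : ℕ) (hp : p.Prime) (hq : q.Prime) (hpq : p ≠ q) (hpo : Odd p) (hqo : Odd q) (x y : ℤ)
    (hx : x ≠ 0) (hy : y ≠ 0) (h : x ^ p - y ^ q = 1) :
    (q : ℤ) ^ 2 ∣ x ∧ (p : ℤ) ^ (q - 1) ≡ 1 [ZMOD ((q : ℤ) ^ 2)] := by
  have : Fact p.Prime := ⟨hp⟩
  obtain ⟨hpy, hqx⟩ := mf_cassels p q hp hq hpq hpo hqo x y hx hy h
  obtain ⟨a, u, k, h1, h2, h3, h4, h5⟩ := mf_rel p q hp hq hpo hqo x y hy h hpy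
  have : NeZero p := ⟨hp.ne_zero⟩
  have : NumberField (CyclotomicField p ℚ) := inferInstance
  have : IsCyclotomicExtension {p} ℚ (CyclotomicField p ℚ) := CyclotomicField.isCyclotomicExtension p ℚ
  obtain ⟨D⟩ := mf_data p hpo (CyclotomicField p ℚ)
  have hq2 := hq.two_le
  have hpx : (p : ℤ) ∣ x - 1 := by
    rw [h1]; exact (dvd_pow_self _ (by omega)).mul_right _
  have hxq := D.q_sq_dvd hpo q hq hqo hpq x u k hqx hpx h2 h4 h5
  refine ⟨hxq, ?_⟩
  -- p^(q-1) ≡ 1 mod q, so a^q ≡ -1 mod q, a ≡ -1 mod q, a^q ≡ -1 mod q^2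
  have hqp : ¬ q ∣ p := fun hd => hpq ((Nat.prime_dvd_prime_iff_eq hq hp).1 hd).symm
  have : Fact q.Prime := ⟨hq⟩
  have hf : (p : ZMod q) ^ (q - 1) = 1 := ZMod.pow_card_sub_one_eq_one (by
    rw [Ne, ZMod.natCast_eq_zero_iff]; exact hqp)
  have ha : (a : ZMod q) = -1 := by
    have h6 := congrArg (Int.cast (R := ZMod q)) h1
    push_cast at h6
    rw [hf, ZMod.pow_card, one_mul, (ZMod.intCast_zmod_eq_zero_iff_dvd x q).2 hqx] at h6
    rw [← h6]; ring
  have ha' : (q : ℤ) ∣ a - (-1) := by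
    rw [← ZMod.intCast_zmod_eq_zero_iff_dvd]; push_cast; rw [ha]; ring
  have ha2 : (q : ℤ) ^ 2 ∣ a ^ q + 1 := by
    have h7 := dvd_sub_pow_of_dvd_sub (p := q) (k := 1) (a := a) (b := -1) ha'
    rw [pow_one, hqo.neg_one_pow] at h7
    simpa using h7
  rw [Int.modEq_comm, Int.modEq_iff_dvd]
  have : (p : ℤ) ^ (q - 1) - 1 = p ^ (q - 1) * (a ^ q + 1) - x := by linear_combination h1
  rw [this]
  exact dvd_sub (ha2.mul_left _) hxq

theorem mihailescu_first (p q : ℕ) (hp : p.Prime) (hq : q.Prime)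
    (hpodd : Odd p) (hqodd : Odd q) (hpq : p ≠ q) (x y : ℤ) (hx : x ≠ 0) (hy : y ≠ 0)
    (h : x ^ p - y ^ q = 1) :
    (p : ℤ) ^ 2 ∣ y ∧ (q : ℤ) ^ 2 ∣ x ∧
      (p : ℤ) ^ (q - 1) ≡ 1 [ZMOD ((q : ℤ) ^ 2)] ∧
      (q : ℤ) ^ (p - 1) ≡ 1 [ZMOD ((p : ℤ) ^ 2)] := by
  obtain ⟨h1, h2⟩ := mf_half p q hp hq hpq hpodd hqodd x y hx hy h
  obtain ⟨h3, h4⟩ := mf_half q p hq hp hpq.symm hqodd hpodd (-y) (-x) (neg_ne_zero.2 hy) (neg_ne_zero.2 hx) (by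
    rw [hpodd.neg_pow, hqodd.neg_pow]; linear_combination h)
  exact ⟨(dvd_neg).1 h3, h1, h2, h4⟩
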